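/- arXiv:2004.14318 — 2 statements merged into one kernel-verified Lean document; each statement's English description precedes it below -/
import Mathlib

section
/- Let n ∈ ℕ and let G ⊆ K_{n,n} be a sorted ordered graph with representing sequence (d_1,k_1),…,(d_t,k_t) satisfying d_{i+1} > k_i for all i ∈ {1,…,t−1}. Set k_0 = 0 and d_{t+1} = n, and for each i ∈ {1,…,t} let G_i be the induced subgraph of G on the left vertices {a_{k_{i−1}+1}, …, a_{d_{i+1}}} and the right vertices {b_{k_{i−1}+1}, …, b_{d_{i+1}}}, regarded as a balanced bipartite graph on n_i = d_{i+1} − k_{i−1} left and right vertices. Then a*_G = ∏_{i=1}^{t} a*_{G_i}, where a*_{G_i} is the dual coefficient of G_i with respect to BPM*_{n_i}. -/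
open Finset

/-- An edge set `E ⊆ {1,…,n}×{1,…,n}` contains a perfect matching. -/
def hasPM (n : ℕ) (E : Finset (Fin n × Fin n)) : Prop :=
  ∃ σ : Equiv.Perm (Fin n), ∀ i : Fin n, (i, σ i) ∈ E

open scoped Classical in
/-- The Boolean dual of the bipartite perfect matching function: `1` iff the
complement of `E` contains no perfect matching, `0` otherwise. -/
noncomputable def bpmStar (n : ℕ) (E : Finset (Fin n × Fin n)) : ℝ :=
  if hasPM n (Finset.univ \ E) then 0 else 1

/-- The dual coefficient `a*_G` of a graph `G ⊆ K_{n,n}`: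
`a*_G = Σ_{F ⊆ E(G)} (−1)^{|E(G)\F|} · BPM*_n(F)`. -/
noncomputable def dualCoeff (n : ℕ) (G : Finset (Fin n × Fin n)) : ℝ :=
  ∑ F ∈ G.powerset, (-1 : ℝ) ^ ((G \ F).card) * bpmStar n F

/-- The induced subgraph of `G ⊆ K_{n,n}` on left vertices `a_{s+1},…,a_{s+m}` and
right vertices `b_{s+1},…,b_{s+m}`, regarded as a balanced bipartite graph on `m`
left and `m` right vertices (`0`-indexed: offset `s`, size `m`). -/
def inducedBlock (n : ℕ) (G : Finset (Fin n × Fin n)) (s m : ℕ) :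
    Finset (Fin m × Fin m) :=
  Finset.univ.filter (fun p =>
    ∃ a b : Fin n, (a : ℕ) = s + (p.1 : ℕ) ∧ (b : ℕ) = s + (p.2 : ℕ) ∧ (a, b) ∈ G)

section AltSum

variable {α β : Type*}

open scoped Classical in
/-- The real-valued indicator of a proposition. -/
noncomputable def ind (p : Prop) : ℝ := if p then 1 else 0

lemma ind_of_true {p : Prop} (h : p) : ind p = 1 := if_pos h

lemma ind_of_false {p : Prop} (h : ¬p) : ind p = 0 := if_neg h

lemma ind_and (p q : Prop) : ind (p ∧ q) = ind p * ind q := by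
  by_cases hp : p <;> by_cases hq : q <;> simp [ind, hp, hq]

lemma ind_not (p : Prop) : ind (¬p) = 1 - ind p := by
  by_cases hp : p <;> simp [ind, hp]

lemma ind_congr {p q : Prop} (h : p ↔ q) : ind p = ind q := by rw [propext h]

open scoped Classical in
/-- The alternating sum of `φ` over the sets `X ∪ Gᶜ`, where `X` ranges over the subsets of
`B ∩ G`. -/
noncomputable def altSum (G : Set α) (B : Finset α) (φ : Set α → ℝ) : ℝ :=
  ∑ X ∈ (B.filter (· ∈ G)).powerset, (-1 : ℝ) ^ X.card * φ (↑X ∪ Gᶜ)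

lemma altSum_eq_sum {G : Set α} {B S : Finset α} (φ : Set α → ℝ)
    (hS : ∀ a, a ∈ S ↔ a ∈ B ∧ a ∈ G) :
    altSum G B φ = ∑ X ∈ S.powerset, (-1 : ℝ) ^ X.card * φ (↑X ∪ Gᶜ) := by
  classical
  have h : B.filter (· ∈ G) = S := by
    ext a
    rw [mem_filter, hS]
  rw [← h, altSum]

lemma altSum_transport (f : α → β) {G : Set α} {G' : Set β} {B : Finset α} {B' : Finset β}
    {φ : Set α → ℝ} {φ' : Set β → ℝ} (hf : Set.InjOn f B) (hB : Set.image f B = B')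
    (hG : ∀ a ∈ B, f a ∈ G' ↔ a ∈ G)
    (hφ : ∀ E E', (∀ a ∈ B, a ∈ E ↔ f a ∈ E') → φ E = φ' E') :
    altSum G B φ = altSum G' B' φ' := by
  classical
  obtain rfl : B.image f = B' := by
    apply Finset.coe_injective
    rw [Finset.coe_image, hB]
  have hF : (B.image f).filter (· ∈ G') = (B.filter (· ∈ G)).image f := by
    ext b
    simp only [mem_filter, mem_image]
    constructor
    · rintro ⟨⟨a, ha, rfl⟩, h⟩
      exact ⟨a, ⟨ha, (hG a ha).1 h⟩, rfl⟩
    · rintro ⟨a, ⟨ha, h⟩, rfl⟩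
      exact ⟨⟨a, ha, rfl⟩, (hG a ha).2 h⟩
  have hinj : Set.InjOn f (B.filter (· ∈ G)) :=
    hf.mono (by simp only [coe_subset]; exact filter_subset _ _)
  unfold altSum
  rw [hF, powerset_image, sum_image (image_injOn_powerset_of_injOn hinj)]
  refine sum_congr rfl fun X hX => ?_
  have hXB : X ⊆ B := (mem_powerset.1 hX).trans (filter_subset _ _)
  rw [card_image_of_injOn (hf.mono (by exact_mod_cast hXB))]
  congr 1
  apply hφ
  intro a ha
  simp only [Set.mem_union, mem_coe, Set.mem_compl_iff, mem_image, hG a ha]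
  refine or_congr_left ⟨fun h => ⟨a, h, rfl⟩, ?_⟩
  rintro ⟨x, hx, hxa⟩
  rwa [← hf (hXB hx) ha hxa]

/-- The value of `φ` at a set only depends on the intersection of this set with `B`. -/
def DependsOnly (φ : Set α → ℝ) (B : Finset α) : Prop :=
  ∀ E E' : Set α, (∀ a ∈ B, a ∈ E ↔ a ∈ E') → φ E = φ E'

lemma altSum_mul [DecidableEq α] {G : Set α} {B B₁ B₂ : Finset α} {φ φ₁ φ₂ : Set α → ℝ}
    (hd : Disjoint B₁ B₂) (hB : B = B₁ ∪ B₂) (hφ : ∀ E, φ E = φ₁ E * φ₂ E)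
    (h₁ : DependsOnly φ₁ B₁) (h₂ : DependsOnly φ₂ B₂) :
    altSum G B φ = altSum G B₁ φ₁ * altSum G B₂ φ₂ := by
  classical
  subst hB
  unfold altSum
  rw [sum_mul_sum, ← sum_product']
  rw [disjoint_left] at hd
  refine sum_nbij' (fun X => (X ∩ B₁, X ∩ B₂)) (fun p => p.1 ∪ p.2) ?_ ?_ ?_ ?_ ?_
  · intro X hX
    simp only [mem_product, mem_powerset, subset_iff, mem_inter, mem_filter, mem_union] at hX ⊢
    exact ⟨fun a ha => ⟨ha.2, (hX ha.1).2⟩, fun a ha => ⟨ha.2, (hX ha.1).2⟩⟩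
  · rintro ⟨X, Y⟩ hX
    simp only [mem_product, mem_powerset, subset_iff, mem_filter, mem_union] at hX ⊢
    rintro a (ha | ha)
    · exact ⟨Or.inl (hX.1 ha).1, (hX.1 ha).2⟩
    · exact ⟨Or.inr (hX.2 ha).1, (hX.2 ha).2⟩
  · intro X hX
    simp only [mem_powerset, subset_iff, mem_filter, mem_union] at hX
    ext a
    simp only [mem_union, mem_inter]
    exact ⟨fun h => h.elim And.left And.left,
      fun h => (hX h).1.imp (fun h' => ⟨h, h'⟩) (fun h' => ⟨h, h'⟩)⟩
  · rintro ⟨X, Y⟩ hX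
    simp only [mem_product, mem_powerset, subset_iff, mem_filter] at hX
    refine Prod.ext ?_ ?_
    · ext a
      simp only [mem_inter, mem_union]
      exact ⟨fun h => h.1.resolve_right fun h' => hd h.2 (hX.2 h').1,
        fun h => ⟨Or.inl h, (hX.1 h).1⟩⟩
    · ext a
      simp only [mem_inter, mem_union]
      exact ⟨fun h => h.1.resolve_left fun h' => hd (hX.1 h').1 h.2,
        fun h => ⟨Or.inr h, (hX.2 h).1⟩⟩
  · intro X hX
    simp only [mem_powerset, subset_iff, mem_filter, mem_union] at hX
    have hcard : X.card = (X ∩ B₁).card + (X ∩ B₂).card := by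
      rw [← card_union_of_disjoint]
      · congr 1
        ext a
        simp only [mem_union, mem_inter]
        exact ⟨fun h => (hX h).1.imp (fun h' => ⟨h, h'⟩) (fun h' => ⟨h, h'⟩),
          fun h => h.elim And.left And.left⟩
      · rw [disjoint_left]
        intro a ha hb
        exact hd (mem_inter.1 ha).2 (mem_inter.1 hb).2
    have e₁ : φ₁ (↑X ∪ Gᶜ) = φ₁ (↑(X ∩ B₁) ∪ Gᶜ) := h₁ _ _ fun a ha => by simp [ha]
    have e₂ : φ₂ (↑X ∪ Gᶜ) = φ₂ (↑(X ∩ B₂) ∪ Gᶜ) := h₂ _ _ fun a ha => by simp [ha]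
    rw [hφ, hcard, pow_add, e₁, e₂]
    ring

lemma altSum_const_one (G : Set α) (B : Finset α) :
    altSum G B (fun _ => 1) = ind (∀ a ∈ B, a ∉ G) := by
  classical
  unfold altSum
  have h := sum_powerset_neg_one_pow_card (x := B.filter (· ∈ G))
  have h' := congrArg (Int.cast : ℤ → ℝ) h
  push_cast at h'
  simp only [mul_one, h', ind, filter_eq_empty_iff]
  congr

lemma altSum_disjoint (G : Set α) (B : Finset α) :
    altSum G B (fun E => ind (∀ a ∈ B, a ∉ E)) = ind (∀ a ∈ B, a ∈ G) := by
  classical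
  unfold altSum
  rw [sum_eq_single ∅]
  · simp
  · intro X hX hne
    obtain ⟨a, ha⟩ := nonempty_iff_ne_empty.2 hne
    beta_reduce
    rw [ind_of_false, mul_zero]
    intro h
    exact h a (mem_filter.1 (mem_powerset.1 hX ha)).1 (by simp [ha])
  · simp

lemma altSum_sub (G : Set α) (B : Finset α) (φ ψ : Set α → ℝ) :
    altSum G B (fun E => φ E - ψ E) = altSum G B φ - altSum G B ψ := by
  simp [altSum, mul_sub]

lemma altSum_sum {ι : Type*} (s : Finset ι) (G : Set α) (B : Finset α) (φ : ι → Set α → ℝ) :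
    altSum G B (fun E => ∑ i ∈ s, φ i E) = ∑ i ∈ s, altSum G B (φ i) := by
  simp only [altSum, mul_sum]
  exact sum_comm

end AltSum

section Hall

variable {R C : Type*}

open scoped Classical in
/-- The vertices of `Q` that are joined by `E` to some vertex of `W`. -/
noncomputable def nbr (E : Set (R × C)) (Q : Finset R) (W : Finset C) : Finset R :=
  Q.filter fun r => ∃ c ∈ W, (r, c) ∈ E

lemma mem_nbr {E : Set (R × C)} {Q : Finset R} {W : Finset C} {r : R} :
    r ∈ nbr E Q W ↔ r ∈ Q ∧ ∃ c ∈ W, (r, c) ∈ E := by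
  simp [nbr]

/-- Hall's condition for matching the columns `U` into the rows `Q`. -/
def HallCond (E : Set (R × C)) (Q : Finset R) (U : Finset C) : Prop :=
  ∀ W ⊆ U, W.card ≤ (nbr E Q W).card

/-- Hall's condition with surplus one. -/
def StrictHall (E : Set (R × C)) (Q : Finset R) (U : Finset C) : Prop :=
  ∀ W ⊆ U, W.Nonempty → W.card < (nbr E Q W).card

lemma card_nbr_image {R' C' : Type*} [DecidableEq R'] [DecidableEq C'] {f : R → R'} {g : C → C'}
    {E : Set (R × C)} {E' : Set (R' × C')} {Q : Finset R} {U : Finset C}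
    (hf : Set.InjOn f Q) (hE : ∀ r ∈ Q, ∀ c ∈ U, (r, c) ∈ E ↔ (f r, g c) ∈ E')
    {W : Finset C} (hW : W ⊆ U) :
    (nbr E' (Q.image f) (W.image g)).card = (nbr E Q W).card := by
  have h : nbr E' (Q.image f) (W.image g) = (nbr E Q W).image f := by
    ext x
    simp only [mem_nbr, mem_image]
    constructor
    · rintro ⟨⟨r, hr, rfl⟩, _, ⟨c, hc, rfl⟩, h⟩
      exact ⟨r, ⟨hr, c, hc, (hE r hr c (hW hc)).2 h⟩, rfl⟩
    · rintro ⟨r, ⟨hr, c, hc, h⟩, rfl⟩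
      exact ⟨⟨r, hr, rfl⟩, g c, ⟨c, hc, rfl⟩, (hE r hr c (hW hc)).1 h⟩
  rw [h, card_image_of_injOn (hf.mono fun r hr => (mem_nbr.1 hr).1)]

lemma hallCond_image {R' C' : Type*} [DecidableEq R'] [DecidableEq C'] {f : R → R'} {g : C → C'}
    {E : Set (R × C)} {E' : Set (R' × C')} {Q : Finset R} {U : Finset C}
    (hf : Set.InjOn f Q) (hg : Set.InjOn g U)
    (hE : ∀ r ∈ Q, ∀ c ∈ U, (r, c) ∈ E ↔ (f r, g c) ∈ E') :
    HallCond E Q U ↔ HallCond E' (Q.image f) (U.image g) := by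
  constructor
  · intro h W' hW'
    obtain ⟨W, hW, rfl⟩ := subset_image_iff.1 hW'
    have hW : W ⊆ U := by exact_mod_cast hW
    rw [card_nbr_image hf hE hW]
    exact card_image_le.trans (h W hW)
  · intro h W hW
    rw [← card_nbr_image hf hE hW, ← card_image_of_injOn (hg.mono (by exact_mod_cast hW))]
    exact h _ (image_subset_image hW)

lemma nbr_congr {E E' : Set (R × C)} {Q : Finset R} {U W : Finset C} (hW : W ⊆ U)
    (hE : ∀ p ∈ Q ×ˢ U, p ∈ E ↔ p ∈ E') : nbr E Q W = nbr E' Q W := by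
  ext r
  simp only [mem_nbr]
  refine and_congr_right fun hr => exists_congr fun c => and_congr_right fun hc => ?_
  exact hE _ (mem_product.2 ⟨hr, hW hc⟩)

lemma hallCond_congr {E E' : Set (R × C)} {Q : Finset R} {U : Finset C}
    (hE : ∀ p ∈ Q ×ˢ U, p ∈ E ↔ p ∈ E') : HallCond E Q U ↔ HallCond E' Q U :=
  forall₂_congr fun W hW => by rw [nbr_congr hW hE]

lemma strictHall_congr {E E' : Set (R × C)} {Q : Finset R} {U : Finset C}
    (hE : ∀ p ∈ Q ×ˢ U, p ∈ E ↔ p ∈ E') : StrictHall E Q U ↔ StrictHall E' Q U :=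
  forall₂_congr fun W hW => by rw [nbr_congr hW hE]

lemma HallCond.swap {E : Set (R × C)} {Q : Finset R} {U : Finset C} (hc : Q.card = U.card)
    (h : HallCond E Q U) : HallCond (Prod.swap ⁻¹' E) U Q := by
  classical
  intro W hW
  have h₁ := h (U \ nbr (Prod.swap ⁻¹' E) U W) sdiff_subset
  have h₂ : nbr E Q (U \ nbr (Prod.swap ⁻¹' E) U W) ⊆ Q \ W := by
    intro r hr
    simp only [mem_nbr, mem_sdiff, Set.mem_preimage, Prod.swap_prod_mk, not_and, not_exists] at hr ⊢
    obtain ⟨hr, c, ⟨hcU, hcN⟩, he⟩ := hr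
    exact ⟨hr, fun hrW => hcN hcU r hrW he⟩
  have h₃ := card_le_card h₂
  rw [card_sdiff_of_subset hW] at h₃
  have h₄ : nbr (Prod.swap ⁻¹' E) U W ⊆ U := fun c hc => (mem_nbr.1 hc).1
  rw [card_sdiff_of_subset h₄] at h₁
  have := card_le_card h₄
  have := card_le_card hW
  omega

/-- `(V, P)` is the canonical Dulmage–Mendelsohn pair of `E` on the rows `Q` and the columns `U`:
the columns `V` are matched perfectly to the rows `P`, and there is a surplus elsewhere. -/
structure IsTightPair (E : Set (R × C)) [DecidableEq R] [DecidableEq C] (Q : Finset R)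
    (U V : Finset C) (P : Finset R) : Prop where
  card_eq : P.card = V.card
  not_mem : ∀ p ∈ (Q \ P) ×ˢ V, p ∉ E
  hall : HallCond E P V
  strict : StrictHall E (Q \ P) (U \ V)

variable [DecidableEq R] [DecidableEq C] {E : Set (R × C)} {Q P : Finset R} {U V W : Finset C}

lemma card_nbr_of_hall_of_strict (hP : P ⊆ Q) (h : HallCond E P V)
    (h' : StrictHall E (Q \ P) (U \ V)) (hW : W ⊆ U) :
    W.card ≤ (nbr E Q W).card ∧ ((nbr E Q W).card = W.card → W ⊆ V) := by
  have hsub : nbr E P (W ∩ V) ∪ nbr E (Q \ P) (W \ V) ⊆ nbr E Q W := by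
    intro r hr
    simp only [mem_union, mem_nbr, mem_inter, mem_sdiff] at hr ⊢
    rcases hr with ⟨hr, c, hc, he⟩ | ⟨hr, c, hc, he⟩
    · exact ⟨hP hr, c, hc.1, he⟩
    · exact ⟨hr.1, c, hc.1, he⟩
  have hdisj : Disjoint (nbr E P (W ∩ V)) (nbr E (Q \ P) (W \ V)) := by
    rw [disjoint_left]
    intro r hr hr'
    exact (mem_sdiff.1 (mem_nbr.1 hr').1).2 (mem_nbr.1 hr).1
  have h₁ := card_le_card hsub
  rw [card_union_of_disjoint hdisj] at h₁
  have h₂ := h (W ∩ V) inter_subset_right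
  have h₃ := card_inter_add_card_sdiff W V
  rcases (W \ V).eq_empty_or_nonempty with h₀ | h₀
  · rw [h₀, card_empty] at h₃
    exact ⟨by omega, fun _ => sdiff_eq_empty_iff_subset.1 h₀⟩
  · have h₄ := h' (W \ V) (sdiff_subset_sdiff hW subset_rfl) h₀
    exact ⟨by omega, fun h => by omega⟩

lemma IsTightPair.hallCond (hP : P ⊆ Q) (h : IsTightPair E Q U V P) : HallCond E Q U :=
  fun _ hW => (card_nbr_of_hall_of_strict hP h.hall h.strict hW).1

lemma IsTightPair.nbr_eq (hP : P ⊆ Q) (h : IsTightPair E Q U V P) : nbr E Q V = P := by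
  have hsub : nbr E Q V ⊆ P := by
    intro r hr
    obtain ⟨hr, c, hc, he⟩ := mem_nbr.1 hr
    by_contra hrP
    exact h.not_mem (r, c) (mem_product.2 ⟨mem_sdiff.2 ⟨hr, hrP⟩, hc⟩) he
  refine eq_of_subset_of_card_le hsub ?_
  rw [h.card_eq]
  refine (h.hall V subset_rfl).trans (card_le_card fun r hr => ?_)
  obtain ⟨hr, hc⟩ := mem_nbr.1 hr
  exact mem_nbr.2 ⟨hP hr, hc⟩

lemma IsTightPair.subset_of_tight (hP : P ⊆ Q) (h : IsTightPair E Q U V P) (hW : W ⊆ U)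
    (hc : (nbr E Q W).card = W.card) : W ⊆ V :=
  (card_nbr_of_hall_of_strict hP h.hall h.strict hW).2 hc

lemma IsTightPair.unique {P' : Finset R} {V' : Finset C} (hP : P ⊆ Q) (hV : V ⊆ U)
    (h : IsTightPair E Q U V P) (hP' : P' ⊆ Q) (hV' : V' ⊆ U) (h' : IsTightPair E Q U V' P') :
    V = V' ∧ P = P' := by
  have hVV : V = V' := by
    apply Subset.antisymm
    · exact h'.subset_of_tight hP' hV (by rw [h.nbr_eq hP, h.card_eq])
    · exact h.subset_of_tight hP hV' (by rw [h'.nbr_eq hP', h'.card_eq])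
  refine ⟨hVV, ?_⟩
  rw [← h.nbr_eq hP, ← h'.nbr_eq hP', hVV]

lemma nbr_union (W W' : Finset C) : nbr E Q (W ∪ W') = nbr E Q W ∪ nbr E Q W' := by
  ext r
  simp only [mem_nbr, mem_union]
  constructor
  · rintro ⟨hr, c, hc | hc, he⟩
    · exact Or.inl ⟨hr, c, hc, he⟩
    · exact Or.inr ⟨hr, c, hc, he⟩
  · rintro (⟨hr, c, hc, he⟩ | ⟨hr, c, hc, he⟩)
    · exact ⟨hr, c, Or.inl hc, he⟩
    · exact ⟨hr, c, Or.inr hc, he⟩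

omit [DecidableEq R] [DecidableEq C] in
lemma nbr_mono {W W' : Finset C} (h : W ⊆ W') : nbr E Q W ⊆ nbr E Q W' := by
  intro r hr
  obtain ⟨hr, c, hc, he⟩ := mem_nbr.1 hr
  exact mem_nbr.2 ⟨hr, c, h hc, he⟩

lemma HallCond.tight_union (h : HallCond E Q U) {W W' : Finset C} (hW : W ⊆ U)
    (hc : (nbr E Q W).card = W.card) (hc' : (nbr E Q W').card = W'.card) :
    (nbr E Q (W ∪ W')).card ≤ (W ∪ W').card := by
  have h₁ := card_union_add_card_inter (nbr E Q W) (nbr E Q W')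
  have h₂ := card_union_add_card_inter W W'
  have h₃ := h (W ∩ W') (inter_subset_left.trans hW)
  have h₄ : nbr E Q (W ∩ W') ⊆ nbr E Q W ∩ nbr E Q W' :=
    subset_inter (nbr_mono inter_subset_left) (nbr_mono inter_subset_right)
  have h₅ := card_le_card h₄
  rw [nbr_union]
  omega

lemma HallCond.exists_isTightPair (h : HallCond E Q U) :
    ∃ V ⊆ U, ∃ P ⊆ Q, IsTightPair E Q U V P := by
  have hne : (U.powerset.filter fun W => (nbr E Q W).card = W.card).Nonempty :=
    ⟨∅, mem_filter.2 ⟨empty_mem_powerset _, by simp [nbr]⟩⟩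
  obtain ⟨V, hV, hmax⟩ := exists_max_image _ Finset.card hne
  simp only [mem_filter, mem_powerset] at hV hmax
  have htight : ∀ W ⊆ U, (nbr E Q W).card = W.card → W ⊆ V := by
    intro W hW hc
    have hu := union_subset hV.1 hW
    have h₁ := hmax (V ∪ W) ⟨hu, (h.tight_union hV.1 hV.2 hc).antisymm (h _ hu)⟩
    have h₂ := eq_of_subset_of_card_le subset_union_left h₁
    rw [h₂]
    exact subset_union_right
  refine ⟨V, hV.1, nbr E Q V, fun r hr => (mem_nbr.1 hr).1, hV.2, ?_, ?_, ?_⟩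
  · rintro ⟨r, c⟩ hp he
    simp only [mem_product, mem_sdiff, mem_nbr, not_and, not_exists] at hp
    exact hp.1.2 hp.1.1 c hp.2 he
  · intro W hW
    refine (h W (hW.trans hV.1)).trans (card_le_card fun r hr => ?_)
    exact mem_nbr.2 ⟨nbr_mono hW hr, (mem_nbr.1 hr).2⟩
  · intro W hW hne
    have hWU : W ⊆ U := hW.trans sdiff_subset
    have hdisj : Disjoint V W := by
      rw [disjoint_left]
      exact fun c hc hc' => (mem_sdiff.1 (hW hc')).2 hc
    have hlt : (V ∪ W).card < (nbr E Q (V ∪ W)).card := by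
      refine lt_of_le_of_ne (h _ (union_subset hV.1 hWU)) fun heq => ?_
      obtain ⟨c, hc⟩ := hne
      exact (mem_sdiff.1 (hW hc)).2
        (htight _ (union_subset hV.1 hWU) heq.symm (mem_union_right _ hc))
    have hsub : nbr E Q (V ∪ W) ⊆ nbr E Q V ∪ nbr E (Q \ nbr E Q V) W := by
      intro r hr
      rw [nbr_union, mem_union] at hr
      by_cases hrV : r ∈ nbr E Q V
      · exact mem_union_left _ hrV
      · have hrW := mem_nbr.1 (hr.resolve_left hrV)
        exact mem_union_right _ (mem_nbr.2 ⟨mem_sdiff.2 ⟨hrW.1, hrV⟩, hrW.2⟩)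
    have h₁ := (card_le_card hsub).trans (card_union_le _ _)
    rw [card_union_of_disjoint hdisj] at hlt
    have h₂ := hV.2
    omega

lemma IsTightPair.hallCond_insert (hP : P ⊆ Q) (hV : V ⊆ U) (h : IsTightPair E Q U V P) {c : C}
    (hc : c ∉ U) :
    HallCond E Q (insert c U) ↔ ¬∀ p ∈ (Q \ P) ×ˢ ({c} : Finset C), p ∉ E := by
  constructor
  · intro h' hE
    have h₁ := h' (insert c V) (insert_subset_insert c hV)
    rw [card_insert_of_notMem fun hcV => hc (hV hcV), ← h.card_eq] at h₁
    have h₂ : nbr E Q (insert c V) ⊆ P := by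
      intro r hr
      obtain ⟨hrQ, x, hx, he⟩ := mem_nbr.1 hr
      by_contra hrP
      rcases mem_insert.1 hx with rfl | hx
      · exact hE (r, x) (by simp [hrQ, hrP]) he
      · exact h.not_mem (r, x) (by simp [hrQ, hrP, hx]) he
    have := card_le_card h₂
    omega
  · intro hE W hW
    by_cases hcW : c ∈ W
    · obtain ⟨W, hcW', rfl⟩ : ∃ W', c ∉ W' ∧ insert c W' = W :=
        ⟨W.erase c, by simp, insert_erase hcW⟩
      have hWU : W ⊆ U := fun x hx =>
        (mem_insert.1 (hW (mem_insert_of_mem hx))).resolve_left fun hxc => hcW' (hxc ▸ hx)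
      rw [card_insert_of_notMem hcW']
      have hmono : nbr E Q W ⊆ nbr E Q (insert c W) := nbr_mono (subset_insert _ _)
      rcases ((h.hallCond hP) W hWU).lt_or_eq with hlt | heq
      · exact Nat.succ_le_of_lt (hlt.trans_le (card_le_card hmono))
      · have hWV := h.subset_of_tight hP hWU heq.symm
        rw [heq]
        refine Nat.succ_le_of_lt (card_lt_card ⟨hmono, fun hsub => hE ?_⟩)
        rintro ⟨r, x⟩ hp he
        simp only [mem_product, mem_sdiff, mem_singleton] at hp
        obtain ⟨⟨hr, hrP⟩, rfl⟩ := hp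
        have hrW := hsub (mem_nbr.2 ⟨hr, x, mem_insert_self _ _, he⟩)
        rw [← h.nbr_eq hP] at hrP
        exact hrP (nbr_mono hWV hrW)
    · refine (h.hallCond hP) W fun x hx => (mem_insert.1 (hW hx)).resolve_left ?_
      exact fun hxc => hcW (hxc ▸ hx)

end Hall

section HallSum

variable {R C : Type*}

/-- The alternating sum of the indicator of Hall's condition. -/
noncomputable def hallSum (G : Set (R × C)) (Q : Finset R) (U : Finset C) : ℝ :=
  altSum G (Q ×ˢ U) fun E => ind (HallCond E Q U)

/-- The alternating sum of the indicator of Hall's condition with surplus one. -/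
noncomputable def strictHallSum (G : Set (R × C)) (Q : Finset R) (U : Finset C) : ℝ :=
  altSum G (Q ×ˢ U) fun E => ind (StrictHall E Q U)

lemma hallSum_image {R' C' : Type*} [DecidableEq R'] [DecidableEq C'] {f : R → R'} {g : C → C'}
    {G : Set (R × C)} {G' : Set (R' × C')} {Q : Finset R} {U : Finset C}
    (hf : Set.InjOn f Q) (hg : Set.InjOn g U)
    (hG : ∀ r ∈ Q, ∀ c ∈ U, (f r, g c) ∈ G' ↔ (r, c) ∈ G) :
    hallSum G Q U = hallSum G' (Q.image f) (U.image g) := by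
  refine altSum_transport (Prod.map f g) ?_ ?_ ?_ ?_
  · rw [coe_product]
    exact hf.prodMap hg
  · simp only [coe_product, coe_image, Set.prodMap_image_prod]
  · rintro ⟨r, c⟩ hp
    exact hG r (mem_product.1 hp).1 c (mem_product.1 hp).2
  · intro E E' hE
    exact ind_congr (hallCond_image hf hg fun r hr c hc => hE (r, c) (mem_product.2 ⟨hr, hc⟩))

lemma hallSum_swap {G : Set (R × C)} {Q : Finset R} {U : Finset C} (hc : Q.card = U.card) :
    hallSum G Q U = hallSum (Prod.swap ⁻¹' G) U Q := by
  refine altSum_transport Prod.swap Prod.swap_injective.injOn ?_ ?_ ?_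
  · simp only [coe_product, Set.image_swap_prod]
  · simp
  · intro E E' hE
    refine ind_congr ⟨fun h => ?_, fun h => ?_⟩
    · refine (hallCond_congr ?_).1 (h.swap hc)
      rintro ⟨c, r⟩ hp
      exact hE (r, c) (mem_product.2 (mem_product.1 hp).symm)
    · refine (hallCond_congr ?_).2 (h.swap hc.symm)
      rintro ⟨r, c⟩ hp
      exact hE (r, c) hp

@[simp]
lemma hallSum_empty (G : Set (R × C)) (Q : Finset R) : hallSum G Q ∅ = 1 := by
  simp [hallSum, altSum, HallCond, ind]

variable [DecidableEq R] [DecidableEq C]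

lemma altSum_isTightPair (G : Set (R × C)) {Q P : Finset R} {U V : Finset C} (hP : P ⊆ Q)
    (hV : V ⊆ U) :
    altSum G (Q ×ˢ U) (fun E => ind (IsTightPair E Q U V P)) =
      ind (P.card = V.card) * (ind (∀ p ∈ (Q \ P) ×ˢ V, p ∈ G) *
        (ind (∀ p ∈ P ×ˢ (U \ V), p ∉ G) *
          (hallSum G P V * strictHallSum G (Q \ P) (U \ V)))) := by
  by_cases hc : P.card = V.card
  swap
  · rw [ind_of_false hc, zero_mul]
    have : ∀ E : Set (R × C), ¬IsTightPair E Q U V P := fun E h => hc h.card_eq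
    simp [altSum, ind, this]
  rw [ind_of_true hc, one_mul]
  have hdP : Disjoint (Q \ P) P := sdiff_disjoint
  have hdV : Disjoint V (U \ V) := disjoint_sdiff
  have hall_dep : DependsOnly (fun E : Set (R × C) => ind (HallCond E P V)) (P ×ˢ V) :=
    fun E E' h => ind_congr (hallCond_congr h)
  have strict_dep : DependsOnly (fun E : Set (R × C) => ind (StrictHall E (Q \ P) (U \ V)))
      ((Q \ P) ×ˢ (U \ V)) := fun E E' h => ind_congr (strictHall_congr h)
  rw [altSum_mul (B := Q ×ˢ U) (B₁ := (Q \ P) ×ˢ V) (B₂ := P ×ˢ (U \ V) ∪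
      (P ×ˢ V ∪ (Q \ P) ×ˢ (U \ V)))
      (φ₁ := fun E => ind (∀ p ∈ (Q \ P) ×ˢ V, p ∉ E))
      (φ₂ := fun E => 1 * (ind (HallCond E P V) * ind (StrictHall E (Q \ P) (U \ V)))),
    altSum_disjoint,
    altSum_mul (B₁ := P ×ˢ (U \ V)) (B₂ := P ×ˢ V ∪ (Q \ P) ×ˢ (U \ V)) (φ₁ := fun _ => 1)
      (φ₂ := fun E => ind (HallCond E P V) * ind (StrictHall E (Q \ P) (U \ V))) _ rfl
      (fun _ => rfl),
    altSum_const_one,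
    altSum_mul (B₁ := P ×ˢ V) (B₂ := (Q \ P) ×ˢ (U \ V)) (φ₁ := fun E => ind (HallCond E P V))
      (φ₂ := fun E => ind (StrictHall E (Q \ P) (U \ V))) _ rfl (fun _ => rfl) hall_dep strict_dep]
  · rfl
  · exact disjoint_product.2 (Or.inl hdP.symm)
  · exact fun _ _ _ => rfl
  · intro E E' h
    exact congrArg₂ _ (hall_dep _ _ fun a ha => h a (mem_union_left _ ha))
      (strict_dep _ _ fun a ha => h a (mem_union_right _ ha))
  · rw [disjoint_union_right]
    exact ⟨disjoint_product.2 (Or.inr hdV.symm), disjoint_product.2 (Or.inl hdP.symm)⟩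
  · rw [disjoint_union_right, disjoint_union_right]
    exact ⟨disjoint_product.2 (Or.inl hdP), disjoint_product.2 (Or.inl hdP),
      disjoint_product.2 (Or.inr hdV)⟩
  · ext ⟨r, c⟩
    simp only [mem_product, mem_union, mem_sdiff]
    have h₁ : r ∈ P → r ∈ Q := fun h => hP h
    have h₂ : c ∈ V → c ∈ U := fun h => hV h
    tauto
  · intro E
    rw [one_mul, ← ind_and, ← ind_and]
    exact ind_congr ⟨fun h => ⟨h.not_mem, h.hall, h.strict⟩, fun h => ⟨hc, h.1, h.2.1, h.2.2⟩⟩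
  · exact fun E E' h => ind_congr (forall₂_congr fun p hp => not_congr (h p hp))
  · intro E E' h
    refine congrArg (1 * ·) (congrArg₂ _ (hall_dep _ _ fun a ha => h a ?_)
      (strict_dep _ _ fun a ha => h a ?_))
    · exact mem_union_right _ (mem_union_left _ ha)
    · exact mem_union_right _ (mem_union_right _ ha)

lemma IsTightPair.sum_mul_eq {E : Set (R × C)} {Q P : Finset R} {U V : Finset C} (hP : P ⊆ Q)
    (hV : V ⊆ U) (h : IsTightPair E Q U V P) (x : Finset C → Finset R → ℝ) :
    ∑ V ∈ U.powerset, ∑ P ∈ Q.powerset, ind (IsTightPair E Q U V P) * x V P = x V P := by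
  rw [sum_eq_single V, sum_eq_single P]
  · rw [ind_of_true h, one_mul]
  · intro P' hP' hne
    rw [ind_of_false, zero_mul]
    exact fun h' => hne (h.unique hP hV (mem_powerset.1 hP') hV h').2.symm
  · exact fun h' => absurd (mem_powerset.2 hP) h'
  · intro V' hV' hne
    refine sum_eq_zero fun P' hP' => ?_
    rw [ind_of_false, zero_mul]
    exact fun h' => hne (h.unique hP hV (mem_powerset.1 hP') (mem_powerset.1 hV') h').1.symm
  · exact fun h' => absurd (mem_powerset.2 hV) h'

lemma ind_hallCond_eq_sum (E : Set (R × C)) (Q : Finset R) (U : Finset C) :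
    ind (HallCond E Q U) =
      ∑ V ∈ U.powerset, ∑ P ∈ Q.powerset, ind (IsTightPair E Q U V P) := by
  by_cases h : HallCond E Q U
  · obtain ⟨V, hV, P, hP, ht⟩ := h.exists_isTightPair
    rw [ind_of_true h]
    simpa using (ht.sum_mul_eq hP hV fun _ _ => 1).symm
  · rw [ind_of_false h, eq_comm]
    exact sum_eq_zero fun V _ => sum_eq_zero fun P hP =>
      ind_of_false fun h' => h (h'.hallCond (mem_powerset.1 hP))

lemma ind_hallCond_insert_eq_sum (E : Set (R × C)) (Q : Finset R) {U : Finset C} {c : C}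
    (hc : c ∉ U) :
    ind (HallCond E Q (insert c U)) =
      ∑ V ∈ U.powerset, ∑ P ∈ Q.powerset, ind (IsTightPair E Q U V P) *
        (1 - ind (∀ p ∈ (Q \ P) ×ˢ ({c} : Finset C), p ∉ E)) := by
  by_cases h : HallCond E Q U
  · obtain ⟨V, hV, P, hP, ht⟩ := h.exists_isTightPair
    rw [ht.sum_mul_eq hP hV fun _ P => 1 - ind (∀ p ∈ (Q \ P) ×ˢ ({c} : Finset C), p ∉ E),
      ← ind_not]
    exact ind_congr (ht.hallCond_insert hP hV hc)
  · rw [ind_of_false fun h' => h fun W hW => h' W (hW.trans (subset_insert _ _)), eq_comm]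
    refine sum_eq_zero fun V _ => sum_eq_zero fun P hP => ?_
    rw [ind_of_false fun h' => h (h'.hallCond (mem_powerset.1 hP)), zero_mul]

/-- Sum over all tight pairs. -/
lemma hallSum_eq_sum (G : Set (R × C)) (Q : Finset R) (U : Finset C) :
    hallSum G Q U = ∑ V ∈ U.powerset, ∑ P ∈ Q.powerset,
      ind (P.card = V.card) * (ind (∀ p ∈ (Q \ P) ×ˢ V, p ∈ G) *
        (ind (∀ p ∈ P ×ˢ (U \ V), p ∉ G) *
          (hallSum G P V * strictHallSum G (Q \ P) (U \ V)))) := by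
  rw [hallSum]
  simp only [ind_hallCond_eq_sum, altSum_sum]
  exact sum_congr rfl fun V hV => sum_congr rfl fun P hP =>
    altSum_isTightPair G (mem_powerset.1 hP) (mem_powerset.1 hV)

lemma altSum_column {G : Set (R × C)} {Q P P₀ : Finset R} {c : C} (hP₀ : P₀ ⊆ Q) (hne : P₀ ≠ Q)
    (hG : ∀ r ∈ Q, (r, c) ∈ G ↔ r ∉ P₀) (hP : P ⊆ Q) :
    altSum G (Q ×ˢ {c}) (fun E => 1 - ind (∀ p ∈ (Q \ P) ×ˢ ({c} : Finset C), p ∉ E)) =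
      -ind (P = P₀) := by
  have h₁ : altSum G (Q ×ˢ {c}) (fun _ => 1) = 0 := by
    rw [altSum_const_one, ind_of_false]
    intro h
    refine hne (hP₀.antisymm fun r hr => ?_)
    by_contra hr'
    exact h (r, c) (by simp [hr]) ((hG r hr).2 hr')
  rw [altSum_sub, h₁, zero_sub,
    altSum_mul (B₁ := (Q \ P) ×ˢ {c}) (B₂ := P ×ˢ {c}) (φ₂ := fun _ => 1) _ _
      (fun _ => (mul_one _).symm) _ (fun _ _ _ => rfl), altSum_disjoint, altSum_const_one,
    ← ind_and]
  · congr 1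
    refine ind_congr ⟨fun ⟨h, h'⟩ => ?_, ?_⟩
    · ext r
      constructor
      · intro hr
        by_contra hr'
        exact h' (r, c) (by simp [hr]) ((hG r (hP hr)).2 hr')
      · intro hr
        by_contra hr'
        exact (hG r (hP₀ hr)).1 (h (r, c) (by simp [hr', hP₀ hr])) hr
    · rintro rfl
      refine ⟨?_, ?_⟩
      · rintro ⟨r, x⟩ hp
        simp only [mem_product, mem_sdiff, mem_singleton] at hp
        obtain ⟨⟨hr, hr'⟩, rfl⟩ := hp
        exact (hG r hr).2 hr'
      · rintro ⟨r, x⟩ hp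
        simp only [mem_product, mem_singleton] at hp
        obtain ⟨hr, rfl⟩ := hp
        exact fun h => (hG r (hP hr)).1 h hr
  · exact disjoint_product.2 (Or.inl sdiff_disjoint)
  · rw [← union_product, sdiff_union_of_subset hP]
  · exact fun E E' h => ind_congr (forall₂_congr fun p hp => not_congr (h p hp))

/-- Expansion of the alternating Hall sum along the column `c`. -/
lemma hallSum_insert {G : Set (R × C)} {Q P : Finset R} {U : Finset C} {c : C} (hc : c ∉ U)
    (hP : P ⊆ Q) (hne : P ≠ Q) (hG : ∀ r ∈ Q, (r, c) ∈ G ↔ r ∉ P) :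
    hallSum G Q (insert c U) = -∑ V ∈ U.powerset,
      ind (P.card = V.card) * (ind (∀ p ∈ (Q \ P) ×ˢ V, p ∈ G) *
        (ind (∀ p ∈ P ×ˢ (U \ V), p ∉ G) *
          (hallSum G P V * strictHallSum G (Q \ P) (U \ V)))) := by
  rw [hallSum]
  simp only [ind_hallCond_insert_eq_sum _ _ hc, altSum_sum]
  rw [← sum_neg_distrib]
  refine sum_congr rfl fun V hV => ?_
  have hV := mem_powerset.1 hV
  have h : ∀ P' ∈ Q.powerset, altSum G (Q ×ˢ insert c U) (fun E => ind (IsTightPair E Q U V P') *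
      (1 - ind (∀ p ∈ (Q \ P') ×ˢ ({c} : Finset C), p ∉ E))) =
      altSum G (Q ×ˢ U) (fun E => ind (IsTightPair E Q U V P')) * -ind (P' = P) := by
    intro P' hP'
    have hP' := mem_powerset.1 hP'
    rw [← altSum_column hP hne hG hP']
    refine altSum_mul ?_ ?_ (fun _ => rfl) ?_ ?_
    · exact disjoint_product.2 (Or.inr (disjoint_singleton_right.2 hc))
    · rw [← product_union, union_comm, ← insert_eq]
    · intro E E' h
      have hsub : ∀ {A : Finset R} {B : Finset C}, A ⊆ Q → B ⊆ U →
          ∀ p ∈ A ×ˢ B, p ∈ E ↔ p ∈ E' := fun hA hB p hp => h p (product_subset_product hA hB hp)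
      have h₁ := hallCond_congr (hsub hP' hV)
      have h₂ := strictHall_congr (hsub (sdiff_subset (t := P')) (sdiff_subset (t := V)))
      have h₃ := hsub (sdiff_subset (t := P')) hV
      refine ind_congr ⟨fun ht => ⟨ht.1, fun p hp => ?_, h₁.1 ht.3, h₂.1 ht.4⟩,
        fun ht => ⟨ht.1, fun p hp => ?_, h₁.2 ht.3, h₂.2 ht.4⟩⟩
      · exact fun he => ht.2 p hp ((h₃ p hp).2 he)
      · exact fun he => ht.2 p hp ((h₃ p hp).1 he)
    · intro E E' h
      refine congrArg (1 - ·) (ind_congr (forall₂_congr fun p hp => not_congr (h p ?_)))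
      exact product_subset_product sdiff_subset subset_rfl hp
  rw [sum_congr rfl h, sum_eq_single P]
  · rw [ind_of_true rfl, altSum_isTightPair G hP hV]
    ring
  · intro P' _ hne'
    rw [ind_of_false hne', neg_zero, mul_zero]
  · exact fun h' => absurd (mem_powerset.2 hP) h'

lemma hallSum_insert_of_full {G : Set (R × C)} {Q : Finset R} {U : Finset C} {c : C} (hc : c ∉ U)
    (hQ : Q.Nonempty) (hG : ∀ r ∈ Q, (r, c) ∈ G) :
    hallSum G Q (insert c U) = -strictHallSum G Q U := by
  rw [hallSum_insert (P := ∅) hc (empty_subset _) hQ.ne_empty.symm (by simpa using hG),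
    sum_eq_single ∅]
  · simp [ind]
  · intro V _ hne
    rw [ind_of_false, zero_mul]
    rw [card_empty]
    exact fun h => hne (card_eq_zero.1 h.symm)
  · simp

end HallSum

section Complete

variable {R C : Type*} [DecidableEq R] [DecidableEq C]

omit [DecidableEq R] [DecidableEq C] in
@[simp]
lemma strictHallSum_empty (G : Set (R × C)) (Q : Finset R) : strictHallSum G Q ∅ = 1 := by
  have h : ∀ E : Set (R × C), StrictHall E Q ∅ := fun E W hW hne =>
    absurd (subset_empty.1 hW) hne.ne_empty
  simp [strictHallSum, altSum, ind, h]

lemma sum_powerset_ind_card_eq {ι : Type*} (s : Finset ι) (m : ℕ) :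
    ∑ P ∈ s.powerset, ind (P.card = m) = (s.card.choose m : ℝ) := by
  classical
  rw [← card_powersetCard, powersetCard_eq_filter, card_filter]
  push_cast
  exact sum_congr rfl fun P _ => by simp [ind]

omit [DecidableEq R] in
/-- Adding a column without edges of `G` makes a graph with one missing column balanced. -/
lemma hallSum_eq_hallSum_insert {G : Set (R × C)} {Q : Finset R} {U : Finset C} {c : C}
    (hc : c ∉ U) (hcard : Q.card = U.card + 1) (hG : ∀ p ∈ Q ×ˢ U, p ∈ G) :
    hallSum G Q U = hallSum {p : R × C | p.2 ≠ c} Q (insert c U) := by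
  classical
  have hF : ∀ p, p ∈ (Q ×ˢ U).filter (· ∈ G) ↔
      p ∈ Q ×ˢ insert c U ∧ p ∈ {p : R × C | p.2 ≠ c} := by
    rintro ⟨r, x⟩
    simp only [mem_filter, mem_product, mem_insert, Set.mem_ofPred_eq]
    constructor
    · rintro ⟨⟨hr, hx⟩, -⟩
      exact ⟨⟨hr, Or.inr hx⟩, fun hxc => hc (hxc ▸ hx)⟩
    · rintro ⟨⟨hr, hx⟩, hxc⟩
      have hx := hx.resolve_left hxc
      exact ⟨⟨hr, hx⟩, hG (r, x) (mem_product.2 ⟨hr, hx⟩)⟩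
  rw [hallSum, hallSum, altSum_eq_sum _ hF, altSum_eq_sum _ fun p => mem_filter]
  refine sum_congr rfl fun X _ => congrArg ((-1 : ℝ) ^ X.card * ·) (ind_congr ?_)
  have hE : ∀ p ∈ Q ×ˢ U,
      p ∈ (↑X ∪ Gᶜ : Set (R × C)) ↔ p ∈ (↑X ∪ {p : R × C | p.2 ≠ c}ᶜ : Set (R × C)) := by
    intro p hp
    have h₁ := hG p hp
    have h₂ : p.2 ≠ c := fun h => hc (h ▸ (mem_product.1 hp).2)
    simp [h₁, h₂]
  constructor
  · intro h W hW
    by_cases hcW : c ∈ W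
    · have hsub : Q ⊆ nbr (↑X ∪ {p : R × C | p.2 ≠ c}ᶜ) Q W := fun r hr =>
        mem_nbr.2 ⟨hr, c, hcW, Or.inr (by simp)⟩
      refine le_trans ?_ (card_le_card hsub)
      rw [hcard, ← card_insert_of_notMem hc]
      exact card_le_card hW
    · exact (hallCond_congr hE).1 h W fun x hx =>
        (mem_insert.1 (hW hx)).resolve_left fun hxc => hcW (hxc ▸ hx)
  · intro h
    exact (hallCond_congr hE).2 fun W hW => h W (hW.trans (subset_insert _ _))

omit [DecidableEq R] [DecidableEq C] in
lemma hallSum_singleton_singleton {G : Set (R × C)} {r : R} {c : C} (h : (r, c) ∉ G) :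
    hallSum G {r} {c} = 1 := by
  have hF : HallCond Gᶜ {r} {c} := by
    intro W hW
    rcases subset_singleton_iff.1 hW with rfl | rfl
    · simp
    · exact card_le_card_of_injOn (fun _ => r) (fun x _ => mem_nbr.2 ⟨by simp, c, by simp, h⟩)
        (by simp)
  classical
  have hE : (({r} : Finset R) ×ˢ ({c} : Finset C)).filter (· ∈ G) = ∅ := by
    simp [filter_eq_empty_iff, h]
  rw [hallSum, altSum, hE]
  simp [ind, hF]

/-- The alternating Hall sum of a complete balanced graph is `-1`. -/
lemma hallSum_complete {α : Type*} [DecidableEq α] (m : ℕ) :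
    ∀ (G : Set (α × α)) (Q U : Finset α), Q.card = m + 1 → U.card = m + 1 →
      (∀ p ∈ Q ×ˢ U, p ∈ G) → hallSum G Q U = -1 := by
  induction m with
  | zero =>
    intro G Q U hQ hU hG
    obtain ⟨c, rfl⟩ := card_eq_one.1 hU
    obtain ⟨r, rfl⟩ := card_eq_one.1 hQ
    rw [← insert_empty_eq c, hallSum_insert_of_full (by simp) (by simp) (by simpa using hG),
      strictHallSum_empty]
  | succ m ih =>
    intro G Q U hQ hU hG
    have hQne : Q.Nonempty := card_pos.1 (by omega)
    obtain ⟨c, hcU⟩ : U.Nonempty := card_pos.1 (by omega)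
    obtain ⟨U, hc, rfl⟩ : ∃ U', c ∉ U' ∧ insert c U' = U :=
      ⟨U.erase c, by simp, insert_erase hcU⟩
    rw [card_insert_of_notMem hc] at hU
    have hU : U.card = m + 1 := by omega
    have hUne : U.Nonempty := card_pos.1 (by omega)
    have hG' : ∀ p ∈ Q ×ˢ U, p ∈ G := fun p hp =>
      hG p (product_subset_product_right (subset_insert _ _) hp)
    have hrow : hallSum G Q U = -(m + 1) := by
      rw [hallSum_eq_hallSum_insert hc (by omega) hG',
        hallSum_swap (by rw [card_insert_of_notMem hc]; omega)]
      obtain ⟨r, hrQ⟩ := hQne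
      obtain ⟨Q, hr, rfl⟩ : ∃ Q', r ∉ Q' ∧ insert r Q' = Q :=
        ⟨Q.erase r, by simp, insert_erase hrQ⟩
      rw [card_insert_of_notMem hr] at hQ
      have hQ : Q.card = m + 1 := by omega
      have hne : ({c} : Finset α) ≠ insert c U := by
        intro h
        have := congrArg Finset.card h
        rw [card_insert_of_notMem hc, card_singleton] at this
        omega
      rw [hallSum_insert (P := {c}) hr (by simp) hne (by simp)]
      have hUc : insert c U \ {c} = U := by
        rw [sdiff_singleton_eq_erase, erase_insert hc]
      have hterm : ∀ V ∈ Q.powerset,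
          ind (({c} : Finset α).card = V.card) *
            (ind (∀ p ∈ (insert c U \ {c}) ×ˢ V, p ∈ Prod.swap ⁻¹' {p : α × α | p.2 ≠ c}) *
            (ind (∀ p ∈ ({c} : Finset α) ×ˢ (Q \ V), p ∉ Prod.swap ⁻¹' {p : α × α | p.2 ≠ c}) *
            (hallSum (Prod.swap ⁻¹' {p : α × α | p.2 ≠ c}) {c} V *
              strictHallSum (Prod.swap ⁻¹' {p : α × α | p.2 ≠ c}) (insert c U \ {c}) (Q \ V)))) =
          ind (V.card = 1) := by
        intro V hV
        have hV := mem_powerset.1 hV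
        by_cases h1 : V.card = 1
        swap
        · rw [ind_of_false h1, ind_of_false, zero_mul]
          rw [card_singleton]
          exact fun h => h1 h.symm
        obtain ⟨v, rfl⟩ := card_eq_one.1 h1
        have hvQ : v ∈ Q := hV (mem_singleton_self v)
        have hfull : ∀ x ∈ U, ∀ y : α, (x, y) ∈ Prod.swap ⁻¹' {p : α × α | p.2 ≠ c} :=
          fun x hx y hxc => hc (hxc ▸ hx)
        have hs : strictHallSum (Prod.swap ⁻¹' {p : α × α | p.2 ≠ c}) U (Q \ {v}) = 1 := by
          have h₁ := hallSum_insert_of_full (G := Prod.swap ⁻¹' {p : α × α | p.2 ≠ c}) (c := v)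
            (U := Q \ {v}) (by simp) hUne fun x hx => hfull x hx v
          rw [sdiff_singleton_eq_erase, insert_erase hvQ,
            ih _ U Q hU hQ fun p hp => hfull p.1 (mem_product.1 hp).1 p.2] at h₁
          rw [sdiff_singleton_eq_erase]
          linarith
        have hfull' : ∀ p ∈ U ×ˢ {v}, p ∈ Prod.swap ⁻¹' {p : α × α | p.2 ≠ c} :=
          fun p hp => hfull p.1 (mem_product.1 hp).1 p.2
        have hempty : ∀ p ∈ {c} ×ˢ (Q \ {v}), p ∉ Prod.swap ⁻¹' {p : α × α | p.2 ≠ c} := by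
          intro p hp
          have := mem_singleton.1 (mem_product.1 hp).1
          simp [this]
        rw [hUc, hs, hallSum_singleton_singleton (by simp), ind_of_true hfull',
          ind_of_true hempty, ind_of_true h1, ind_of_true (by simp)]
        ring
      rw [sum_congr rfl hterm, sum_powerset_ind_card_eq, hQ, Nat.choose_one_right]
      push_cast
      ring
    have hsum := hallSum_eq_sum G Q U
    rw [sum_eq_add (∅ : Finset α) U hUne.ne_empty.symm] at hsum
    · have h₀ : ∑ P ∈ Q.powerset, ind (P.card = (∅ : Finset α).card) *
          (ind (∀ p ∈ (Q \ P) ×ˢ ∅, p ∈ G) * (ind (∀ p ∈ P ×ˢ (U \ ∅), p ∉ G) *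
            (hallSum G P ∅ * strictHallSum G (Q \ P) (U \ ∅)))) = strictHallSum G Q U := by
        rw [sum_eq_single ∅]
        · simp [ind]
        · intro P _ hP
          rw [ind_of_false, zero_mul]
          rwa [card_empty, card_eq_zero]
        · simp
      have h₁ : ∑ P ∈ Q.powerset, ind (P.card = U.card) *
          (ind (∀ p ∈ (Q \ P) ×ˢ U, p ∈ G) * (ind (∀ p ∈ P ×ˢ (U \ U), p ∉ G) *
            (hallSum G P U * strictHallSum G (Q \ P) (U \ U)))) = -(m + 2) := by
        have hterm : ∀ P ∈ Q.powerset, ind (P.card = U.card) *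
          (ind (∀ p ∈ (Q \ P) ×ˢ U, p ∈ G) * (ind (∀ p ∈ P ×ˢ (U \ U), p ∉ G) *
            (hallSum G P U * strictHallSum G (Q \ P) (U \ U)))) = -ind (P.card = m + 1) := by
          intro P hP
          have hP := mem_powerset.1 hP
          rw [hU]
          by_cases hPc : P.card = m + 1
          · rw [ih G P U hPc hU fun p hp => hG' p (product_subset_product_left hP hp),
              ind_of_true fun p hp => hG' p (product_subset_product_left sdiff_subset hp),
              Finset.sdiff_self, strictHallSum_empty,
              ind_of_true (p := ∀ p ∈ P ×ˢ _, p ∉ G) (by simp)]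
            ring
          · rw [ind_of_false hPc]
            ring
        rw [sum_congr rfl hterm, sum_neg_distrib, sum_powerset_ind_card_eq, hQ,
          Nat.choose_succ_self_right]
        push_cast
        ring
      rw [h₀, h₁, hrow] at hsum
      rw [hallSum_insert_of_full hc hQne fun r hr => hG _ (mem_product.2 ⟨hr, mem_insert_self _ _⟩)]
      linarith
    · intro V hV hne
      have hV := mem_powerset.1 hV
      refine sum_eq_zero fun P hP => ?_
      have hP := mem_powerset.1 hP
      by_cases hPV : P.card = V.card
      · obtain ⟨x, hx, hxV⟩ : ∃ x ∈ U, x ∉ V := by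
          by_contra! h
          exact hne.2 (hV.antisymm h)
        obtain ⟨r, hr⟩ : P.Nonempty := by
          rw [← card_pos, hPV, card_pos]
          exact nonempty_iff_ne_empty.2 hne.1
        rw [ind_of_false (p := ∀ p ∈ P ×ˢ (U \ V), p ∉ G)]
        · ring
        · exact fun h => h (r, x) (by simp [hr, hx, hxV])
            (hG' _ (mem_product.2 ⟨hP hr, hx⟩))
      · rw [ind_of_false hPV, zero_mul]
    · simp
    · simp

end Complete

section Interval

/-- The columns `V` can be moved to the left when the columns to the left of `D` are full. -/
lemma hallSum_Ico_sdiff {G : Set (ℕ × ℕ)} {s k D N : ℕ} {V : Finset ℕ} (hsk : s ≤ k) (hkD : k ≤ D)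
    (hDN : D ≤ N) (hG : ∀ r c, k ≤ r → r < N → s ≤ c → c < D → (r, c) ∈ G)
    (hV : V ⊆ Ico s D) (hcard : V.card = k - s) :
    hallSum G (Ico k N) (Ico s N \ V) = hallSum G (Ico k N) (Ico k N) := by
  have hAc : (Ico s D \ V).card = (Ico k D).card := by
    rw [card_sdiff_of_subset hV, hcard, Nat.card_Ico, Nat.card_Ico]
    omega
  let e := equivOfCardEq hAc
  let g : ℕ → ℕ := fun c => if h : c ∈ Ico s D \ V then e ⟨c, h⟩ else c
  have hg₁ : ∀ c (h : c ∈ Ico s D \ V), g c = e ⟨c, h⟩ := fun c h => dif_pos h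
  have hg₂ : ∀ c, D ≤ c → g c = c := fun c hc => dif_neg fun h => by
    have := mem_Ico.1 (mem_sdiff.1 h).1
    omega
  have hgA : ∀ c, c ∈ Ico s D \ V → k ≤ g c ∧ g c < D := fun c h => by
    rw [hg₁ c h]
    exact mem_Ico.1 (e ⟨c, h⟩).2
  have hcase : ∀ c ∈ Ico s N \ V, c ∈ Ico s D \ V ∨ D ≤ c := by
    intro c hc
    simp only [mem_sdiff, mem_Ico] at hc ⊢
    by_cases h : D ≤ c
    · exact Or.inr h
    · exact Or.inl ⟨⟨hc.1.1, by omega⟩, hc.2⟩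
  have hinj : Set.InjOn g (Ico s N \ V : Finset ℕ) := by
    intro x hx y hy hxy
    rcases hcase x hx with hx' | hx' <;> rcases hcase y hy with hy' | hy'
    · rw [hg₁ x hx', hg₁ y hy'] at hxy
      exact congrArg Subtype.val (e.injective (Subtype.ext hxy))
    · rw [hg₂ y hy'] at hxy
      have := hgA x hx'
      omega
    · rw [hg₂ x hx'] at hxy
      have := hgA y hy'
      omega
    · rwa [hg₂ x hx', hg₂ y hy'] at hxy
  have himage : (Ico s N \ V).image g = Ico k N := by
    ext y
    rw [mem_image, mem_Ico]
    constructor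
    · rintro ⟨x, hx, rfl⟩
      rcases hcase x hx with hx' | hx'
      · have := hgA x hx'
        omega
      · rw [hg₂ x hx']
        have := mem_Ico.1 (mem_sdiff.1 hx).1
        omega
    · rintro ⟨hky, hyN⟩
      by_cases hy : D ≤ y
      · refine ⟨y, mem_sdiff.2 ⟨mem_Ico.2 ⟨by omega, hyN⟩, fun hyV => ?_⟩, hg₂ y hy⟩
        have := mem_Ico.1 (hV hyV)
        omega
      · have hyD : y ∈ Ico k D := mem_Ico.2 ⟨hky, by omega⟩
        have hx := (e.symm ⟨y, hyD⟩).2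
        refine ⟨e.symm ⟨y, hyD⟩, ?_, ?_⟩
        · simp only [mem_sdiff, mem_Ico] at hx ⊢
          exact ⟨⟨hx.1.1, by omega⟩, hx.2⟩
        · rw [hg₁ _ hx]
          simp
  rw [hallSum_image (f := id) (g := g) (G' := G) Function.injective_id.injOn hinj, himage,
    image_id]
  intro r hr c hc
  have hr := mem_Ico.1 hr
  rcases hcase c hc with hc' | hc'
  · have h₁ := hgA c hc'
    have h₂ := mem_Ico.1 (mem_sdiff.1 hc').1
    exact iff_of_true (hG _ _ hr.1 hr.2 (by omega) h₁.2) (hG _ _ hr.1 hr.2 h₂.1 h₂.2)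
  · rw [hg₂ c hc', id]

lemma hallSum_Ico_eq_sum_mul {G : Set (ℕ × ℕ)} {s k d D N : ℕ} (hsk : s < k) (hsd : s ≤ d)
    (hdD : d < D) (hkD : k < D) (hDN : D ≤ N)
    (h₁ : ∀ r c, s ≤ r → r < k → s ≤ c → c < N → ((r, c) ∈ G ↔ c < d))
    (h₂ : ∀ r c, k ≤ r → r < N → s ≤ c → c < D → (r, c) ∈ G)
    (h₃ : ∀ c, D ≤ c → c < N → (k, c) ∉ G) :
    hallSum G (Ico s N) (Ico s N) =
      (∑ V ∈ ((Ico s D).erase d).powerset.filter fun V => V.card = k - s ∧ Ico s d ⊆ V,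
        hallSum G (Ico s k) V) * hallSum G (Ico k N) (Ico k N) := by
  have hd : d ∈ Ico s N := mem_Ico.2 ⟨hsd, by omega⟩
  have hP : Ico s N \ Ico s k = Ico k N := by
    ext r
    simp only [mem_sdiff, mem_Ico]
    omega
  have hPQ : Ico s k ⊆ Ico s N := Ico_subset_Ico_right (by omega)
  have hne : Ico s k ≠ Ico s N := by
    intro h
    have := congrArg Finset.card h
    rw [Nat.card_Ico, Nat.card_Ico] at this
    omega
  have hcol : ∀ r ∈ Ico s N, (r, d) ∈ G ↔ r ∉ Ico s k := by
    intro r hr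
    have hr := mem_Ico.1 hr
    rw [mem_Ico]
    by_cases hrk : r < k
    · simp [h₁ r d hr.1 hrk hsd (by omega), hr.1, hrk]
    · simp [h₂ r d (by omega) hr.2 hsd hdD, hrk]
  have hexp := hallSum_insert (U := (Ico s N).erase d) (notMem_erase d _) hPQ hne hcol
  rw [insert_erase hd, hP] at hexp
  rw [hexp, sum_mul, ← sum_neg_distrib]
  symm
  refine sum_subset_zero_on_sdiff ?_ ?_ ?_
  · intro V hV
    simp only [mem_filter, mem_powerset] at hV ⊢
    exact hV.1.trans (erase_subset_erase _ (Ico_subset_Ico_right hDN))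
  · intro V hV
    simp only [mem_sdiff, mem_filter, mem_powerset, not_and] at hV
    obtain ⟨hVN, hV⟩ := hV
    rw [Nat.card_Ico]
    by_cases hc : k - s = V.card
    swap
    · rw [ind_of_false hc]
      ring
    by_cases hVD : V ⊆ (Ico s D).erase d
    · obtain ⟨c, hc, hcV⟩ := not_subset.1 (hV hVD hc.symm)
      have hc := mem_Ico.1 hc
      rw [ind_of_false (p := ∀ p ∈ Ico s k ×ˢ _, p ∉ G)]
      · ring
      · refine fun h => h (s, c) ?_ ((h₁ s c le_rfl hsk hc.1 (by omega)).2 hc.2)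
        simp only [mem_product, mem_Ico, mem_sdiff, mem_erase]
        exact ⟨⟨le_rfl, hsk⟩, ⟨by omega, by omega, by omega⟩, hcV⟩
    · obtain ⟨c, hcV, hc⟩ := not_subset.1 hVD
      have hcN := hVN hcV
      simp only [mem_erase, mem_Ico] at hcN hc
      rw [ind_of_false (p := ∀ p ∈ Ico k N ×ˢ V, p ∈ G)]
      · ring
      · refine fun h => h₃ c (by omega) (by omega) (h (k, c) ?_)
        simp only [mem_product, mem_Ico]
        exact ⟨⟨le_rfl, by omega⟩, hcV⟩
  · intro V hV
    simp only [mem_filter, mem_powerset] at hV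
    obtain ⟨hVD, hc, hdV⟩ := hV
    have hVD' : V ⊆ Ico s D := hVD.trans (erase_subset _ _)
    have hdV' : d ∉ V := fun h => notMem_erase d _ (hVD h)
    have hins : insert d ((Ico s N).erase d \ V) = Ico s N \ V := by
      rw [← insert_sdiff_of_notMem _ hdV', insert_erase hd]
    have hfull := hallSum_insert_of_full (G := G) (Q := Ico k N) (c := d)
      (U := (Ico s N).erase d \ V) (by simp) (nonempty_Ico.2 (by omega))
      fun r hr => h₂ r d (mem_Ico.1 hr).1 (mem_Ico.1 hr).2 hsd hdD
    rw [hins, hallSum_Ico_sdiff hsk.le hkD.le hDN h₂ hVD' hc] at hfull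
    rw [hfull, Nat.card_Ico, ind_of_true hc.symm, ind_of_true (p := ∀ p ∈ Ico k N ×ˢ V, p ∈ G),
      ind_of_true]
    · ring
    · rintro ⟨r, c⟩ hp
      simp only [mem_product, mem_sdiff, mem_erase, mem_Ico] at hp
      rw [h₁ r c hp.1.1 hp.1.2 hp.2.1.2.1 hp.2.1.2.2]
      exact fun hcd => hp.2.2 (hdV (mem_Ico.2 ⟨hp.2.1.2.1, hcd⟩))
    · rintro ⟨r, c⟩ hp
      have hr := mem_Ico.1 (mem_product.1 hp).1
      have hc := mem_Ico.1 (hVD' (mem_product.1 hp).2)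
      exact h₂ r c hr.1 hr.2 hc.1 hc.2

lemma hallSum_Ico_split {G : Set (ℕ × ℕ)} {s k d D n : ℕ} (hsk : s < k) (hsd : s ≤ d)
    (hdD : d < D) (hkD : k < D) (hDn : D ≤ n)
    (h₁ : ∀ r c, s ≤ r → r < k → s ≤ c → c < n → ((r, c) ∈ G ↔ c < d))
    (h₂ : ∀ r c, k ≤ r → r < n → s ≤ c → c < D → (r, c) ∈ G)
    (h₃ : ∀ c, D ≤ c → c < n → (k, c) ∉ G) :
    -hallSum G (Ico s n) (Ico s n) =
      -hallSum G (Ico s D) (Ico s D) * -hallSum G (Ico k n) (Ico k n) := by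
  have hcomplete : hallSum G (Ico k D) (Ico k D) = -1 := by
    have hcard : (Ico k D).card = (D - k - 1) + 1 := by
      rw [Nat.card_Ico]
      omega
    refine hallSum_complete _ G _ _ hcard hcard ?_
    rintro ⟨r, c⟩ hp
    simp only [mem_product, mem_Ico] at hp
    exact h₂ r c (by omega) (by omega) (by omega) (by omega)
  rw [hallSum_Ico_eq_sum_mul hsk hsd hdD hkD hDn h₁ h₂ h₃,
    hallSum_Ico_eq_sum_mul hsk hsd hdD hkD le_rfl
      (fun r c hr hr' hc hc' => h₁ r c hr hr' hc (by omega))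
      (fun r c hr hr' => h₂ r c hr (by omega)) (fun c hc hc' => by omega), hcomplete]
  ring

end Interval

section DualCoeff

lemma hasPM_iff_hallCond (n : ℕ) (E : Finset (Fin n × Fin n)) :
    hasPM n E ↔ HallCond (E : Set (Fin n × Fin n)) univ univ := by
  classical
  have h := all_card_le_biUnion_card_iff_exists_injective
    (fun c : Fin n => univ.filter fun r : Fin n => (r, c) ∈ E)
  have hnbr : ∀ W : Finset (Fin n), nbr (E : Set (Fin n × Fin n)) univ W =
      W.biUnion fun c => univ.filter fun r : Fin n => (r, c) ∈ E := by
    intro W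
    ext r
    simp [mem_nbr]
  have h' : HallCond (E : Set (Fin n × Fin n)) univ univ ↔
      ∃ f : Fin n → Fin n, Function.Injective f ∧
        ∀ x, f x ∈ univ.filter fun r : Fin n => (r, x) ∈ E := by
    rw [← h]
    refine forall_congr' fun W => ?_
    rw [hnbr]
    simp
  rw [h']
  constructor
  · rintro ⟨σ, hσ⟩
    exact ⟨σ.symm, σ.symm.injective, fun x => by simpa using hσ (σ.symm x)⟩
  · rintro ⟨f, hf, hfE⟩
    refine ⟨(Equiv.ofBijective f (Finite.injective_iff_bijective.1 hf)).symm, fun i => ?_⟩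
    obtain ⟨x, rfl⟩ := (Finite.injective_iff_bijective.1 hf).surjective i
    rw [Equiv.ofBijective_symm_apply_apply]
    simpa using hfE x

lemma dualCoeff_eq_neg_hallSum {n : ℕ} {G : Finset (Fin n × Fin n)} (hG : G.Nonempty) :
    dualCoeff n G = -hallSum (G : Set (Fin n × Fin n)) univ univ := by
  classical
  have h₀ : altSum (G : Set (Fin n × Fin n)) (univ ×ˢ univ) (fun _ => 1) = 0 := by
    rw [altSum_const_one, ind_of_false]
    obtain ⟨p, hp⟩ := hG
    exact fun h => h p (by simp) (by simpa using hp)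
  have hF : ∀ p, p ∈ G ↔ p ∈ (univ ×ˢ univ : Finset (Fin n × Fin n)) ∧
      p ∈ (G : Set (Fin n × Fin n)) := by
    simp
  rw [← zero_sub, ← h₀, hallSum, ← altSum_sub, dualCoeff, altSum_eq_sum _ hF]
  refine sum_nbij' (fun F => G \ F) (fun X => G \ X) ?_ ?_ ?_ ?_ ?_
  · exact fun F _ => mem_powerset.2 sdiff_subset
  · exact fun F _ => mem_powerset.2 sdiff_subset
  · exact fun F hF => Finset.sdiff_sdiff_eq_self (mem_powerset.1 hF)
  · exact fun F hF => Finset.sdiff_sdiff_eq_self (mem_powerset.1 hF)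
  · intro F hF
    have hset : ((univ \ F : Finset (Fin n × Fin n)) : Set (Fin n × Fin n)) =
        ↑(G \ F) ∪ (G : Set (Fin n × Fin n))ᶜ := by
      ext p
      have hp : p ∈ F → p ∈ G := fun h => mem_powerset.1 hF h
      simp only [coe_sdiff, Set.mem_sdiff, Set.mem_union, Set.mem_compl_iff, mem_coe, mem_univ]
      tauto
    rw [← hset, ← ind_congr (hasPM_iff_hallCond n _), bpmStar, ind]
    split_ifs <;> simp

/-- The edge set of a graph on `Fin n` as a set of pairs of natural numbers. -/
def natEdges {n : ℕ} (G : Finset (Fin n × Fin n)) : Set (ℕ × ℕ) :=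
  {p | ∃ a b : Fin n, (a : ℕ) = p.1 ∧ (b : ℕ) = p.2 ∧ (a, b) ∈ G}

lemma mk_mem_natEdges {n : ℕ} {G : Finset (Fin n × Fin n)} {a b : ℕ} (ha : a < n) (hb : b < n) :
    (a, b) ∈ natEdges G ↔ ((⟨a, ha⟩, ⟨b, hb⟩) : Fin n × Fin n) ∈ G := by
  constructor
  · rintro ⟨x, y, rfl, rfl, h⟩
    exact h
  · exact fun h => ⟨_, _, rfl, rfl, h⟩

lemma inducedBlock_zero_self (n : ℕ) (G : Finset (Fin n × Fin n)) :
    inducedBlock n G 0 n = G := by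
  ext ⟨a, b⟩
  simp only [inducedBlock, mem_filter, mem_univ, true_and, zero_add]
  constructor
  · rintro ⟨x, y, hx, hy, h⟩
    rwa [← Fin.ext hx, ← Fin.ext hy]
  · exact fun h => ⟨a, b, rfl, rfl, h⟩

lemma dualCoeff_inducedBlock {n s e a b : ℕ} {G : Finset (Fin n × Fin n)} (ha : a ∈ Ico s e)
    (hb : b ∈ Ico s e) (hab : (a, b) ∈ natEdges G) :
    dualCoeff (e - s) (inducedBlock n G s (e - s)) =
      -hallSum (natEdges G) (Ico s e) (Ico s e) := by
  have hlift : ∀ x ∈ Ico s e, ∃ i : Fin (e - s), s + (i : ℕ) = x := by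
    intro x hx
    have hx := mem_Ico.1 hx
    exact ⟨⟨x - s, by omega⟩, by simp only; omega⟩
  have hmem : ∀ i j : Fin (e - s),
      (s + (i : ℕ), s + (j : ℕ)) ∈ natEdges G ↔ (i, j) ∈ inducedBlock n G s (e - s) := by
    intro i j
    simp [natEdges, inducedBlock]
  have himage : (univ : Finset (Fin (e - s))).image (fun i : Fin (e - s) => s + (i : ℕ)) =
      Ico s e := by
    ext x
    simp only [mem_image, mem_univ, true_and]
    refine ⟨?_, hlift x⟩
    rintro ⟨i, rfl⟩
    have := i.2
    rw [mem_Ico]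
    omega
  have hinj : Function.Injective fun i : Fin (e - s) => s + (i : ℕ) :=
    fun i j hij => Fin.ext (by simpa using hij)
  obtain ⟨i, rfl⟩ := hlift a ha
  obtain ⟨j, rfl⟩ := hlift b hb
  rw [dualCoeff_eq_neg_hallSum ⟨(i, j), (hmem i j).1 hab⟩,
    hallSum_image (G' := natEdges G) hinj.injOn hinj.injOn fun r _ c _ => by
      rw [hmem, mem_coe], himage]

end DualCoeff

/-- Block decomposition: for a sorted ordered graph `G` with representing sequence
`(d_1,k_1),…,(d_t,k_t)` satisfying `d_{i+1} > k_i` for `1 ≤ i ≤ t−1` (with `k_0 = 0`,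
`d_{t+1} = n`), the dual coefficient factors as
`a*_G = ∏_{i=1}^{t} a*_{G_i}`, where `G_i` is the induced subgraph of `G` on the
left/right vertices indexed `k_{i−1}+1,…,d_{i+1}`, a graph on `n_i = d_{i+1} − k_{i−1}`
left and right vertices. -/
theorem dual_coeff_block_decomposition (n t : ℕ) (ht : 1 ≤ t) (d k : ℕ → ℕ)
    (G : Finset (Fin n × Fin n))
    (hk0 : k 0 = 0)
    (hdmono : ∀ i, 1 ≤ i → i < t → d i < d (i + 1))
    (hdn : d t ≤ n)
    (hdt1 : d (t + 1) = n)
    (hkmono : ∀ i, i < t → k i < k (i + 1))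
    (hkt : k t = n)
    (hG : ∀ j, 1 ≤ j → j ≤ t → ∀ a b : Fin n,
      k (j - 1) ≤ (a : ℕ) → (a : ℕ) < k j → ((a, b) ∈ G ↔ (b : ℕ) < d j))
    (hsep : ∀ i, 1 ≤ i → i ≤ t - 1 → k i < d (i + 1)) :
    dualCoeff n G =
      ∏ i ∈ Finset.Icc 1 t,
        dualCoeff (d (i + 1) - k (i - 1))
          (inducedBlock n G (k (i - 1)) (d (i + 1) - k (i - 1))) := by
  have hk : ∀ i j, i ≤ j → j ≤ t → k i ≤ k j := by
    intro i j hij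
    induction j, hij using Nat.le_induction with
    | base => exact fun _ => le_rfl
    | succ j _ ih => exact fun hj => (ih (by omega)).trans (hkmono j (by omega)).le
  have hd : ∀ i j, 1 ≤ i → i ≤ j → j ≤ t → d i ≤ d j := by
    intro i j hi hij
    induction j, hij using Nat.le_induction with
    | base => exact fun _ => le_rfl
    | succ j _ ih => exact fun hj => (ih (by omega)).trans (hdmono j (by omega) (by omega)).le
  have hrow : ∀ r < n, ∀ i < t, k i ≤ r → ∃ j, i < j ∧ j ≤ t ∧ k (j - 1) ≤ r ∧ r < k j := by
    intro r hr i hi hir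
    have hex : ∃ j, r < k j := ⟨t, by omega⟩
    have hspec := Nat.find_spec hex
    have hle : Nat.find hex ≤ t := Nat.find_min' hex (by omega)
    have hlt : i < Nat.find hex := by
      by_contra! h
      have := hk _ i h hi.le
      omega
    refine ⟨Nat.find hex, hlt, hle, ?_, hspec⟩
    exact not_lt.1 (Nat.find_min hex (m := Nat.find hex - 1) (by omega))
  have hmem : ∀ j, 1 ≤ j → j ≤ t → ∀ r c, k (j - 1) ≤ r → r < k j → c < n →
      ((r, c) ∈ natEdges G ↔ c < d j) := by
    intro j hj hjt r c hr hr' hc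
    have := hk j t hjt le_rfl
    rw [mk_mem_natEdges (by omega) hc]
    exact hG j hj hjt ⟨r, by omega⟩ ⟨c, hc⟩ hr hr'
  have hdle : ∀ i, 1 ≤ i → i ≤ t → d i ≤ n := fun i hi hit => (hd i t hi hit le_rfl).trans hdn
  rcases ht.eq_or_lt with rfl | ht
  · rw [Icc_self, prod_singleton, hdt1, hk0, Nat.sub_zero, inducedBlock_zero_self]
  have hedge : ∀ i, 1 ≤ i → i < t → (k i, k (i - 1)) ∈ natEdges G := by
    intro i hi hit
    have h₁ := hsep i hi (by omega)
    have h₂ := hdle (i + 1) (by omega) hit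
    have h₃ := hk (i - 1) i (by omega) hit.le
    have h := hmem (i + 1) (by omega) hit (k i) (k (i - 1)) le_rfl (hkmono i hit) (by omega)
    rw [h]
    omega
  have hlast : (k (t - 1), k (t - 1)) ∈ natEdges G := by
    have h₁ := hsep (t - 1) (by omega) le_rfl
    have h₂ := hkmono (t - 1) (by omega)
    rw [Nat.sub_add_cancel ht.le] at h₁ h₂
    exact (hmem t ht.le le_rfl _ _ le_rfl h₂ (by omega)).2 h₁
  have hblock : ∀ i, 1 ≤ i → i ≤ t →
      dualCoeff (d (i + 1) - k (i - 1)) (inducedBlock n G (k (i - 1)) (d (i + 1) - k (i - 1))) =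
        -hallSum (natEdges G) (Ico (k (i - 1)) (d (i + 1))) (Ico (k (i - 1)) (d (i + 1))) := by
    intro i hi hit
    rcases hit.eq_or_lt with rfl | hit
    · have h := hkmono (i - 1) (by omega)
      rw [Nat.sub_add_cancel hi] at h
      refine dualCoeff_inducedBlock (mem_Ico.2 ⟨le_rfl, ?_⟩) (mem_Ico.2 ⟨le_rfl, ?_⟩) hlast <;>
        omega
    · have h₁ := hsep i hi (by omega)
      have h₃ := hk (i - 1) i (by omega) hit.le
      refine dualCoeff_inducedBlock (mem_Ico.2 ⟨?_, ?_⟩) (mem_Ico.2 ⟨?_, ?_⟩) (hedge i hi hit) <;>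
        omega
  have hsplit : ∀ i, 1 ≤ i → i < t →
      -hallSum (natEdges G) (Ico (k (i - 1)) n) (Ico (k (i - 1)) n) =
        -hallSum (natEdges G) (Ico (k (i - 1)) (d (i + 1))) (Ico (k (i - 1)) (d (i + 1))) *
          -hallSum (natEdges G) (Ico (k i) n) (Ico (k i) n) := by
    intro i hi hit
    have hki := hkmono (i - 1) (by omega)
    rw [Nat.sub_add_cancel hi] at hki
    have hkd : k (i - 1) ≤ d i := by
      rcases hi.eq_or_lt with rfl | hi
      · simp [hk0]
      · have h := hsep (i - 1) (by omega) (by omega)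
        rw [Nat.sub_add_cancel (by omega)] at h
        exact h.le
    refine hallSum_Ico_split hki hkd (hdmono i hi hit) (hsep i hi (by omega))
      (hdle (i + 1) (by omega) hit) ?_ ?_ ?_
    · exact fun r c hr hr' _ hc => hmem i hi hit.le r c hr hr' hc
    · intro r c hr hr' _ hc
      obtain ⟨j, hij, hjt, h₁, h₂⟩ := hrow r hr' i hit hr
      have h₃ := hd (i + 1) j (by omega) hij hjt
      have h₄ := hdle j (by omega) hjt
      exact (hmem j (by omega) hjt r c h₁ h₂ (by omega)).2 (by omega)
    · intro c hc hc'
      have h := hmem (i + 1) (by omega) hit (k i) c le_rfl (hkmono i hit) hc'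
      rw [h]
      omega
  have hprefix : ∀ i, 1 ≤ i → i ≤ t →
      -hallSum (natEdges G) (Ico 0 n) (Ico 0 n) =
        (∏ l ∈ Ico 1 i, -hallSum (natEdges G) (Ico (k (l - 1)) (d (l + 1)))
          (Ico (k (l - 1)) (d (l + 1)))) *
        -hallSum (natEdges G) (Ico (k (i - 1)) n) (Ico (k (i - 1)) n) := by
    intro i hi
    induction i, hi using Nat.le_induction with
    | base => simp [hk0]
    | succ i hi ih =>
      intro hit
      rw [ih (by omega), hsplit i hi (by omega), prod_Ico_succ_top hi, Nat.add_sub_cancel]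
      ring
  have hwhole := dualCoeff_inducedBlock (s := 0) (e := n) (mem_Ico.2 ⟨Nat.zero_le _, ?_⟩)
    (mem_Ico.2 ⟨Nat.zero_le _, ?_⟩) hlast
  · rw [Nat.sub_zero, inducedBlock_zero_self] at hwhole
    rw [hwhole, hprefix t ht.le le_rfl, prod_congr rfl fun i hi =>
      hblock i (mem_Icc.1 hi).1 (mem_Icc.1 hi).2, ← Ico_add_one_right_eq_Icc,
      prod_Ico_succ_top ht.le, hdt1]
  all_goals
    have h := hkmono (t - 1) (by omega)
    rw [Nat.sub_add_cancel ht.le] at h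
    omega
end

section
/- Let n ∈ ℕ. For every graph G ⊆ K_{n,n}, the dual coefficient of G satisfies |a*_G| ≤ 2^{2n}. -/
open Finset

section ChainSum

variable {α : Type*} [PartialOrder α]

theorem Finset.exists_le_of_isChain {C : Finset α} (hC : IsChain (· ≤ ·) (C : Set α))
    (hne : C.Nonempty) : ∃ m ∈ C, ∀ c ∈ C, m ≤ c := by
  obtain ⟨m, hm⟩ := C.exists_minimal hne
  refine ⟨m, hm.1, fun c hc => ?_⟩
  rcases hC.total (Finset.mem_coe.2 hm.1) (Finset.mem_coe.2 hc) with h | h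
  · exact h
  · exact hm.2 hc h

open scoped Classical in
/-- The chains `C ⊆ L` lying strictly above `s` and containing every element of `A` that is
strictly above `s`. -/
noncomputable def chainsAbove (L A : Finset α) (s : α) : Finset (Finset α) :=
  {C ∈ L.powerset |
    IsChain (· ≤ ·) (C : Set α) ∧ (∀ c ∈ C, s < c) ∧ ∀ a ∈ A, s < a → a ∈ C}

theorem mem_chainsAbove {L A : Finset α} {s : α} {C : Finset α} :
    C ∈ chainsAbove L A s ↔ C ⊆ L ∧ IsChain (· ≤ ·) (C : Set α) ∧ (∀ c ∈ C, s < c) ∧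
      ∀ a ∈ A, s < a → a ∈ C := by
  simp [chainsAbove]

/-- The signed count of the chains in `chainsAbove L A s`. -/
noncomputable def chainSum (L A : Finset α) (s : α) : ℝ :=
  ∑ C ∈ chainsAbove L A s, (-1) ^ #C

open scoped Classical in
/-- The possible least elements of a chain in `chainsAbove L A s`. -/
noncomputable def leastAbove (L A : Finset α) (s : α) : Finset α :=
  {t ∈ L | s < t ∧ ∀ a ∈ A, s < a → t ≤ a}

theorem mem_leastAbove {L A : Finset α} {s t : α} :
    t ∈ leastAbove L A s ↔ t ∈ L ∧ s < t ∧ ∀ a ∈ A, s < a → t ≤ a := by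
  simp [leastAbove]

open scoped Classical in
/-- Recursion for `chainSum`, splitting a chain at its least element. -/
theorem chainSum_eq (L A : Finset α) (s : α) :
    chainSum L A s = (if ∀ a ∈ A, ¬ s < a then 1 else 0) -
      ∑ s' ∈ leastAbove L A s, chainSum L A s' := by
  have h1 : ∑ C ∈ chainsAbove L A s with C = ∅, (-1 : ℝ) ^ #C =
      if ∀ a ∈ A, ¬ s < a then 1 else 0 := by
    rw [Finset.sum_filter, Finset.sum_ite_eq']
    simp [mem_chainsAbove]
  have h2 : ∑ s' ∈ leastAbove L A s, chainSum L A s' =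
      ∑ C ∈ chainsAbove L A s with ¬ C = ∅, -(-1 : ℝ) ^ #C := by
    unfold chainSum
    rw [Finset.sum_sigma']
    have hnot : ∀ x ∈ ((leastAbove L A s).sigma
        fun s' => chainsAbove L A s'), x.1 ∉ x.2 := by
      intro x hx hm
      rw [Finset.mem_sigma, mem_chainsAbove] at hx
      exact lt_irrefl _ (hx.2.2.2.1 _ hm)
    refine Finset.sum_bij (fun x _ => insert x.1 x.2) ?_ ?_ ?_ ?_
    · rintro ⟨t, C⟩ hx
      simp only [Finset.mem_sigma, Finset.mem_filter, mem_leastAbove, mem_chainsAbove] at hx ⊢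
      obtain ⟨⟨htL, hst, hta⟩, hCL, hC, hCt, hA⟩ := hx
      refine ⟨⟨Finset.insert_subset htL hCL, ?_, ?_, ?_⟩, Finset.insert_ne_empty _ _⟩
      · rw [Finset.coe_insert]
        exact hC.insert fun b hb _ => Or.inl (hCt b hb).le
      · intro c hc
        rcases Finset.mem_insert.1 hc with rfl | hc
        · exact hst
        · exact hst.trans (hCt c hc)
      · intro a ha hsa
        rcases (hta a ha hsa).eq_or_lt with h | h
        · simp [h]
        · exact Finset.mem_insert_of_mem (hA a ha h)
    · rintro ⟨t, C⟩ hx ⟨t', C'⟩ hx' heq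
      have hn := hnot _ hx
      have hn' := hnot _ hx'
      simp only [Finset.mem_sigma, mem_leastAbove, mem_chainsAbove] at hx hx' heq hn hn'
      have htt : t = t' := by
        have a1 : t ∈ insert t' C' := heq ▸ Finset.mem_insert_self _ _
        have a2 : t' ∈ insert t C := heq ▸ Finset.mem_insert_self _ _
        rcases Finset.mem_insert.1 a1 with h | h
        · exact h
        rcases Finset.mem_insert.1 a2 with h' | h'
        · exact h'.symm
        exact absurd (hx.2.2.2.1 _ h') (hx'.2.2.2.1 _ h).not_gt
      subst htt
      have : C = C' := by
        rw [← Finset.erase_insert hn, ← Finset.erase_insert hn', heq]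
      rw [this]
    · intro C hC
      simp only [Finset.mem_filter, mem_chainsAbove] at hC
      obtain ⟨⟨hCL, hC, hCs, hA⟩, hne⟩ := hC
      obtain ⟨m, hm, hmin⟩ := Finset.exists_le_of_isChain hC (Finset.nonempty_iff_ne_empty.2 hne)
      refine ⟨⟨m, C.erase m⟩, ?_, Finset.insert_erase hm⟩
      simp only [Finset.mem_sigma, mem_leastAbove, mem_chainsAbove]
      refine ⟨⟨hCL hm, hCs m hm, fun a ha hsa => hmin a (hA a ha hsa)⟩,
        (Finset.erase_subset _ _).trans hCL, hC.mono (by simp), ?_, ?_⟩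
      · intro c hc
        rw [Finset.mem_erase] at hc
        exact lt_of_le_of_ne (hmin c hc.2) hc.1.symm
      · intro a ha hma
        exact Finset.mem_erase.2 ⟨hma.ne', hA a ha ((hCs m hm).trans hma)⟩
    · intro x hx
      rw [Finset.card_insert_of_notMem (hnot x hx), pow_succ]
      ring
  rw [h2, chainSum, ← Finset.sum_filter_add_sum_filter_not _ (fun C => C = ∅), h1,
    Finset.sum_neg_distrib, sub_neg_eq_add]

open scoped Classical in
/-- The order complex of `L` above `s` is a cone when joining with a fixed `m` preserves `L`, so
its reduced Euler characteristic vanishes. -/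
theorem chainSum_empty_eq_zero {β : Type*} [SemilatticeSup β] [Fintype β] {L : Finset β} {m : β}
    (hL : ∀ p ∈ L, p ⊔ m ∈ L) {s : β} (hs : s ⊔ m ∈ L) (hm : ¬ m ≤ s) :
    chainSum L ∅ s = 0 := by
  induction s using WellFoundedGT.induction with
  | ind s ih =>
  have key : ∑ s' ∈ leastAbove L ∅ s, chainSum L ∅ s' =
      chainSum L ∅ (s ⊔ m) + ∑ s' ∈ leastAbove L ∅ (s ⊔ m), chainSum L ∅ s' := by
    rw [← Finset.sum_insert (f := fun s' => chainSum L ∅ s') (by simp [mem_leastAbove])]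
    symm
    refine Finset.sum_subset ?_ ?_
    · intro t ht
      simp only [Finset.mem_insert, mem_leastAbove, Finset.notMem_empty, IsEmpty.forall_iff,
        implies_true, and_true] at ht ⊢
      have hlt : s < s ⊔ m := left_lt_sup.2 hm
      rcases ht with rfl | ⟨h1, h2⟩
      · exact ⟨hs, hlt⟩
      · exact ⟨h1, hlt.trans h2⟩
    · intro t ht htn
      simp only [Finset.mem_insert, mem_leastAbove, Finset.notMem_empty, IsEmpty.forall_iff,
        implies_true, and_true, not_or, not_and] at ht htn
      refine ih t ht.2 (hL t ht.1) fun hmt => ?_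
      exact htn.2 ht.1 (lt_of_le_of_ne (sup_le ht.2.le hmt) (Ne.symm htn.1))
  have e1 := chainSum_eq L ∅ s
  have e2 := chainSum_eq L ∅ (s ⊔ m)
  simp only [Finset.notMem_empty, IsEmpty.forall_iff, implies_true, if_true] at e1 e2
  rw [e1, key, e2]
  ring

end ChainSum

section ChainSumFinset

variable {X : Type*} [DecidableEq X]

theorem sum_Ioc_neg_one_pow_card_sdiff {s t : Finset X} (h : s ⊂ t) :
    ∑ u ∈ Finset.Ioc s t, (-1 : ℝ) ^ #(t \ u) = -(-1) ^ #(t \ s) := by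
  have h0 : ∑ u ∈ Finset.Icc s t, (-1 : ℝ) ^ #(t \ u) = 0 := by
    have hz := Finset.sum_powerset_neg_one_pow_card_of_nonempty
      (Finset.sdiff_nonempty.2 h.not_subset)
    have hz' : ∑ m ∈ (t \ s).powerset, (-1 : ℝ) ^ #m = 0 := by exact_mod_cast hz
    rw [← hz']
    refine Finset.sum_nbij' (fun u => t \ u) (fun u => t \ u) ?_ ?_ ?_ ?_ ?_
    · intro u hu
      rw [Finset.mem_Icc] at hu
      exact Finset.mem_powerset.2 (Finset.sdiff_subset_sdiff subset_rfl hu.1)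
    · intro u hu
      rw [Finset.mem_powerset] at hu
      rw [Finset.mem_Icc]
      refine ⟨fun x hx => Finset.mem_sdiff.2 ⟨h.subset hx, fun hxu => ?_⟩, Finset.sdiff_subset⟩
      exact (Finset.mem_sdiff.1 (hu hxu)).2 hx
    · intro u hu
      exact Finset.sdiff_sdiff_eq_self (Finset.mem_Icc.1 hu).2
    · intro u hu
      exact Finset.sdiff_sdiff_eq_self ((Finset.mem_powerset.1 hu).trans Finset.sdiff_subset)
    · intro u _
      rfl
  rw [← Finset.Ioc_insert_left h.subset, Finset.sum_insert Finset.left_notMem_Ioc] at h0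
  linarith

/-- `L` contains, together with `s`, all sets between `s` and the elements of `A` above `s`. -/
def FillsUpTo (L A : Finset (Finset X)) : Prop :=
  ∀ s ∈ L, ∀ t, s ⊆ t → (∀ a ∈ A, s ⊆ a → t ⊆ a) → t ∈ L

variable [Fintype X] {L A : Finset (Finset X)}

theorem chainSum_eq_of_least (hL : FillsUpTo L A) {s a : Finset X} (hs : s ∈ L) (ha : a ∈ A)
    (hsa : s ⊆ a) (hleast : ∀ b ∈ A, s ⊆ b → a ⊆ b) :
    chainSum L A s = (-1) ^ #(a \ s) * chainSum L A a := by
  classical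
  induction s using WellFoundedGT.induction with
  | ind s ih =>
  rcases hsa.eq_or_ssubset with rfl | hss
  · simp
  have hf : leastAbove L A s = Finset.Ioc s a := by
    ext t
    simp only [mem_leastAbove, Finset.mem_Ioc]
    refine ⟨fun h => ⟨h.2.1, h.2.2 a ha hss⟩, fun h => ?_⟩
    exact ⟨hL s hs t h.1.le fun b hb hsb => h.2.trans (hleast b hb hsb), h.1,
      fun b hb hsb => h.2.trans (hleast b hb hsb.le)⟩
  rw [chainSum_eq, if_neg (by push Not; exact ⟨a, ha, hss⟩), hf]
  have : ∀ t ∈ Finset.Ioc s a, chainSum L A t = (-1) ^ #(a \ t) * chainSum L A a := by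
    intro t ht
    have ht' := ht
    rw [← hf, mem_leastAbove] at ht'
    rw [Finset.mem_Ioc] at ht
    exact ih t ht.1 ht'.1 ht.2 fun b hb htb => hleast b hb (ht.1.le.trans htb)
  rw [Finset.sum_congr rfl this, ← Finset.sum_mul, sum_Ioc_neg_one_pow_card_sdiff hss]
  ring

theorem abs_chainSum_le (hL : FillsUpTo L A) (hA : IsChain (· ≤ ·) (A : Set (Finset X)))
    (hLA : ∀ s ∈ L, ∃ a ∈ A, s ⊆ a) (s : Finset X) :
    |chainSum L A s| ≤ 2 ^ (Fintype.card X - #s) := by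
  classical
  induction s using WellFoundedGT.induction with
  | ind s ih =>
  rw [chainSum_eq]
  by_cases hn : ∀ a ∈ A, ¬ s < a
  · rw [if_pos hn, Finset.sum_eq_zero, sub_zero, abs_one]
    · exact one_le_pow₀ one_le_two
    · intro t ht
      rw [mem_leastAbove] at ht
      obtain ⟨a, ha, hta⟩ := hLA t ht.1
      exact absurd (ht.2.1.trans_le hta) (hn a ha)
  · obtain ⟨a, ha, hmin⟩ := Finset.exists_le_of_isChain (C := {a ∈ A | s < a})
      (hA.mono fun a ha => (Finset.mem_filter.1 ha).1) (by
        push Not at hn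
        obtain ⟨a, h⟩ := hn
        exact ⟨a, by simpa using h⟩)
    rw [Finset.mem_filter] at ha
    rw [if_neg hn, zero_sub, abs_neg]
    have hsub : leastAbove L A s ⊆
        Finset.Icc s a := by
      intro t ht
      rw [mem_leastAbove] at ht
      exact Finset.mem_Icc.2 ⟨ht.2.1.le, ht.2.2 a ha.1 ha.2⟩
    calc _ ≤ ∑ t ∈ leastAbove L A s, |chainSum L A t| :=
          Finset.abs_sum_le_sum_abs _ _
      _ ≤ ∑ t ∈ leastAbove L A s, 2 ^ (Fintype.card X - #a) := by
          refine Finset.sum_le_sum fun t ht => ?_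
          rw [mem_leastAbove] at ht
          rw [chainSum_eq_of_least hL ht.1 ha.1 (ht.2.2 a ha.1 ha.2) fun b hb htb =>
            hmin b (Finset.mem_filter.2 ⟨hb, ht.2.1.trans_le htb⟩)]
          rw [abs_mul, abs_neg_one_pow, one_mul]
          exact ih a ha.2
      _ ≤ ∑ t ∈ Finset.Icc s a, 2 ^ (Fintype.card X - #a) :=
          Finset.sum_le_sum_of_subset_of_nonneg hsub fun _ _ _ => by positivity
      _ = 2 ^ (Fintype.card X - #s) := by
          rw [Finset.sum_const, Finset.card_Icc_finset ha.2.le, nsmul_eq_mul]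
          push_cast
          rw [← pow_add]
          congr 1
          have := Finset.card_le_card ha.2.le
          have := Finset.card_le_univ a
          omega

end ChainSumFinset

section SignedSums

open scoped Classical in
theorem sum_piFinset_prod_mul {ι α π : Type*} [Fintype ι] [Fintype π] (t : ι → Finset α)
    (w : ι → α → ℝ) (τ : ι → α → π) (Φ : (ι → π) → ℝ) :
    ∑ a ∈ Fintype.piFinset t, (∏ j, w j (a j)) * Φ (fun j => τ j (a j)) =
      ∑ p : ι → π, Φ p * ∏ j, ∑ a ∈ t j, w j a * if τ j a = p j then 1 else 0 := by
  simp_rw [Finset.prod_univ_sum, Finset.mul_sum]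
  rw [Finset.sum_comm]
  refine Finset.sum_congr rfl fun a _ => ?_
  rw [Finset.sum_eq_single fun j => τ j (a j)]
  · simp [mul_comm]
  · intro p _ hp
    obtain ⟨j, hj⟩ := Function.ne_iff.1 hp
    rw [Finset.prod_eq_zero (Finset.mem_univ j), mul_zero]
    rw [if_neg (Ne.symm hj), mul_zero]
  · simp

/-- If for each coordinate two signed measures have the same push-forward to `π`, then so do their
products. -/
theorem sum_piFinset_prod_mul_eq {ι α β π : Type*} [Fintype ι] [DecidableEq ι] [Fintype π]
    {t : ι → Finset α} {w : ι → α → ℝ} {τ : ι → α → π}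
    {u : ι → Finset β} {v : ι → β → ℝ} {ρ : ι → β → π}
    (h : ∀ j (φ : π → ℝ), ∑ a ∈ t j, w j a * φ (τ j a) = ∑ b ∈ u j, v j b * φ (ρ j b))
    (Φ : (ι → π) → ℝ) :
    ∑ a ∈ Fintype.piFinset t, (∏ j, w j (a j)) * Φ (fun j => τ j (a j)) =
      ∑ b ∈ Fintype.piFinset u, (∏ j, v j (b j)) * Φ (fun j => ρ j (b j)) := by
  classical
  have h1 := sum_piFinset_prod_mul t w τ Φ
  have h2 := sum_piFinset_prod_mul u v ρ Φ
  have h3 : ∀ (p : ι → π) j, ∑ a ∈ t j, w j a * (if τ j a = p j then 1 else 0) =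
      ∑ b ∈ u j, v j b * (if ρ j b = p j then 1 else 0) :=
    fun p j => h j fun q => if q = p j then 1 else 0
  simp only [h3] at h1
  convert h1.trans h2.symm

variable {X : Type*} [DecidableEq X]

theorem sum_powerset_neg_one_pow_mul_eq_zero {G : Finset X} {x : X} (hx : x ∈ G)
    {f : Finset X → ℝ} (hf : ∀ D, x ∉ D → f (insert x D) = f D) :
    ∑ D ∈ G.powerset, (-1) ^ #(G \ D) * f D = 0 := by
  obtain ⟨H, hxH, rfl⟩ : ∃ H, x ∉ H ∧ insert x H = G :=
    ⟨G.erase x, Finset.notMem_erase x G, Finset.insert_erase hx⟩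
  rw [Finset.sum_powerset_insert hxH, ← Finset.sum_add_distrib]
  refine Finset.sum_eq_zero fun D hD => ?_
  have hxD : x ∉ D := fun h => hxH (Finset.mem_powerset.1 hD h)
  rw [hf D hxD, Finset.insert_sdiff_of_notMem _ hxD,
    Finset.card_insert_of_notMem fun h => hxH (Finset.mem_sdiff.1 h).1,
    Finset.insert_sdiff_insert, Finset.sdiff_insert_of_notMem hxH, pow_succ]
  ring

theorem sum_powerset_eq_sub_of_isChain {C : Finset (Finset X)}
    (hC : IsChain (· ≤ ·) (C : Set (Finset X))) {G : Finset X} (hG : G.Nonempty)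
    (φ : Finset (Finset X) → ℝ) :
    ∑ D ∈ G.powerset, (-1) ^ #(G \ D) * φ {S ∈ C | S ⊆ D} =
      φ {S ∈ C | S ⊆ G} - φ {S ∈ C | S ⊂ G} := by
  obtain ⟨x, hxG, hx⟩ : ∃ x ∈ G, ∀ S ∈ C, S ⊂ G → x ∉ S := by
    rcases ({S ∈ C | S ⊂ G} : Finset _).eq_empty_or_nonempty with he | hne
    · obtain ⟨x, hx⟩ := hG
      refine ⟨x, hx, fun S hS hSG => ?_⟩
      rw [Finset.filter_eq_empty_iff] at he
      exact absurd hSG (he hS)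
    · obtain ⟨M, hM⟩ := Finset.exists_maximal hne
      have hM' := Finset.mem_filter.1 hM.1
      obtain ⟨x, hxG, hxM⟩ := Finset.exists_of_ssubset hM'.2
      refine ⟨x, hxG, fun S hS hSG hxS => hxM ?_⟩
      rcases hC.total (Finset.mem_coe.2 hS) (Finset.mem_coe.2 hM'.1) with h | h
      · exact h hxS
      · exact hM.2 (Finset.mem_filter.2 ⟨hS, hSG⟩) h hxS
  have hzero := sum_powerset_neg_one_pow_mul_eq_zero hxG
    (f := fun D => φ {S ∈ C | S ⊂ G ∧ S ⊆ D}) (by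
      intro D hD
      congr 1
      refine Finset.filter_congr fun S hS => and_congr_right fun hSG => ?_
      rw [Finset.subset_insert_iff_of_notMem (hx S hS hSG)])
  have hsplit : ∀ f : Finset X → ℝ, ∑ D ∈ G.powerset, (-1) ^ #(G \ D) * f D =
      f G + ∑ D ∈ G.ssubsets, (-1) ^ #(G \ D) * f D := by
    intro f
    rw [Finset.ssubsets, ← Finset.add_sum_erase _ _ (Finset.mem_powerset_self G)]
    simp
  rw [hsplit] at hzero ⊢
  have hcongr : ∑ D ∈ G.ssubsets, (-1) ^ #(G \ D) * φ {S ∈ C | S ⊂ G ∧ S ⊆ D} =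
      ∑ D ∈ G.ssubsets, (-1) ^ #(G \ D) * φ {S ∈ C | S ⊆ D} := by
    refine Finset.sum_congr rfl fun D hD => ?_
    congr 2
    refine Finset.filter_congr fun S _ => ?_
    exact and_iff_right_of_imp fun h => h.trans_ssubset (Finset.mem_ssubsets.1 hD)
  have hG' : ({S ∈ C | S ⊂ G ∧ S ⊆ G} : Finset _) = {S ∈ C | S ⊂ G} :=
    Finset.filter_congr fun S _ => and_iff_left_of_imp fun h => h.subset
  rw [hcongr, hG'] at hzero
  linarith

/-- The sign with which the column `G` enters, unchanged (`false`) or deprived of itself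
(`true`). -/
def columnSign (G : Finset X) (b : Bool) : ℝ :=
  if b then (if G = ∅ then 0 else -1) else 1

theorem abs_columnSign_le (G : Finset X) (b : Bool) : |columnSign G b| ≤ 1 := by
  unfold columnSign
  split_ifs <;> simp

theorem sum_powerset_eq_sum_bool {C : Finset (Finset X)}
    (hC : IsChain (· ≤ ·) (C : Set (Finset X))) (G : Finset X)
    (φ : Finset (Finset X) → ℝ) :
    ∑ D ∈ G.powerset, (-1) ^ #(G \ D) * φ {S ∈ C | S ⊆ D} =
      ∑ b : Bool, (if G.Nonempty → G ∈ C then columnSign G b else 0) *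
        φ {S ∈ C | S ⊆ G ∧ (b = true → S ≠ G)} := by
  have hss : ({S ∈ C | S ⊆ G ∧ S ≠ G} : Finset _) = {S ∈ C | S ⊂ G} :=
    Finset.filter_congr fun S _ => Finset.ssubset_iff_subset_ne.symm
  rcases G.eq_empty_or_nonempty with rfl | hG
  · simp [columnSign]
  rw [sum_powerset_eq_sub_of_isChain hC hG]
  by_cases hGC : G ∈ C
  · simp [columnSign, hG.ne_empty, hGC, hss]
    ring
  · have : ({S ∈ C | S ⊆ G} : Finset _) = {S ∈ C | S ⊂ G} :=
      Finset.filter_congr fun S hS =>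
        ⟨fun h => h.ssubset_of_ne fun e => hGC (e ▸ hS), fun h => h.subset⟩
    simp [hGC, hG, this]

end SignedSums

section Columns

variable {n : ℕ}

/-- The neighbourhood of the right vertex `j`. -/
def column (F : Finset (Fin n × Fin n)) (j : Fin n) : Finset (Fin n) := {i | (i, j) ∈ F}

theorem mem_column {F : Finset (Fin n × Fin n)} {i j : Fin n} : i ∈ column F j ↔ (i, j) ∈ F := by
  simp [column]

theorem sum_powerset_eq_sum_piFinset_column (G : Finset (Fin n × Fin n))
    (f : (Fin n → Finset (Fin n)) → ℝ) :
    ∑ F ∈ G.powerset, (-1) ^ #(G \ F) * f (column F) =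
      ∑ H ∈ Fintype.piFinset fun j => (column G j).powerset,
        (∏ j, (-1) ^ #(column G j \ H j)) * f H := by
  refine Finset.sum_nbij' column
    (fun H => ({p | p.1 ∈ H p.2} : Finset (Fin n × Fin n))) ?_ ?_ ?_ ?_ ?_
  · intro F hF
    rw [Finset.mem_powerset] at hF
    simp only [Fintype.mem_piFinset, Finset.mem_powerset]
    intro j i hi
    exact mem_column.2 (hF (mem_column.1 hi))
  · intro H hH
    simp only [Fintype.mem_piFinset, Finset.mem_powerset] at hH ⊢
    intro p hp
    exact mem_column.1 (hH p.2 (Finset.mem_filter.1 hp).2)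
  · intro F _
    ext p
    simp [mem_column]
  · intro H _
    ext j i
    simp [mem_column]
  · intro F _
    rw [Finset.prod_pow_eq_pow_sum]
    congr 2
    rw [Finset.card_eq_sum_card_fiberwise (f := Prod.snd) (t := Finset.univ) (by simp)]
    refine Finset.sum_congr rfl fun j _ => ?_
    refine Finset.card_nbij' Prod.fst (fun i => (i, j)) ?_ ?_ ?_ ?_
    · rintro ⟨i, k⟩ h
      simp at h ⊢
      obtain ⟨h, rfl⟩ := h
      simpa [mem_column] using h
    · intro i h
      simpa [mem_column] using h
    · rintro ⟨i, k⟩ h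
      simp at h ⊢
      exact h.2.symm
    · intro i _
      rfl

/-- The sets `S` of left vertices such that `S` and its common neighbourhood in `F` together have
more than `n` elements. -/
def largeSets (F : Finset (Fin n × Fin n)) : Finset (Finset (Fin n)) :=
  {S | n < #S + #{j | S ⊆ column F j}}

theorem mem_largeSets {F : Finset (Fin n × Fin n)} {S : Finset (Fin n)} :
    S ∈ largeSets F ↔ n < #S + #{j | S ⊆ column F j} := by
  simp [largeSets]

theorem hasPM_compl_iff (F : Finset (Fin n × Fin n)) :
    hasPM n (Finset.univ \ F) ↔ largeSets F = ∅ := by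
  have hcard : ∀ S : Finset (Fin n),
      #(S.biUnion fun i => {j | (i, j) ∉ F}) + #{j | S ⊆ column F j} = n := by
    intro S
    have : (S.biUnion fun i => ({j | (i, j) ∉ F} : Finset (Fin n))) =
        ({j | S ⊆ column F j} : Finset (Fin n))ᶜ := by
      ext j
      simp [Finset.subset_iff, mem_column]
    rw [this, Finset.card_compl_add_card, Fintype.card_fin]
  have hall := Finset.all_card_le_biUnion_card_iff_exists_injective
    fun i : Fin n => ({j | (i, j) ∉ F} : Finset (Fin n))
  have hlarge : largeSets F = ∅ ↔
      ∀ S : Finset (Fin n), #S ≤ #(S.biUnion fun i => ({j | (i, j) ∉ F} : Finset (Fin n))) := by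
    rw [Finset.eq_empty_iff_forall_notMem]
    refine forall_congr' fun S => ?_
    rw [mem_largeSets]
    have := hcard S
    omega
  rw [hlarge, hall]
  constructor
  · rintro ⟨σ, hσ⟩
    exact ⟨σ, σ.injective, by simpa using hσ⟩
  · rintro ⟨f, hf, hF⟩
    exact ⟨Equiv.ofBijective f (Finite.injective_iff_bijective.1 hf), by simpa using hF⟩

theorem bpmStar_eq_one_sub_chainSum (F : Finset (Fin n × Fin n)) :
    bpmStar n F = 1 - chainSum (largeSets F) ∅ ∅ := by
  unfold bpmStar
  rw [hasPM_compl_iff]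
  split_ifs with h
  · rw [h, chainSum_eq]
    simp [leastAbove]
  · obtain ⟨M, -, hM⟩ := Finset.exists_max_image Finset.univ
      (fun S : Finset (Fin n) => #S + #{j | S ⊆ column F j}) Finset.univ_nonempty
    obtain ⟨S, hS⟩ := Finset.nonempty_iff_ne_empty.2 h
    have hML : M ∈ largeSets F := by
      rw [mem_largeSets] at hS ⊢
      exact hS.trans_le (hM S (Finset.mem_univ S))
    rw [chainSum_empty_eq_zero (m := M), sub_zero]
    · intro p hp
      rw [mem_largeSets] at hp ⊢
      have hmax := hM (p ∩ M) (Finset.mem_univ _)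
      have h1 : #(p ∪ M) + #(p ∩ M) = #p + #M := Finset.card_union_add_card_inter p M
      have h2 := Finset.card_union_add_card_inter ({j | p ⊆ column F j} : Finset (Fin n))
        {j | M ⊆ column F j}
      have h3 : #(({j | p ⊆ column F j} : Finset (Fin n)) ∪
          ({j | M ⊆ column F j} : Finset (Fin n))) ≤ #{j | p ∩ M ⊆ column F j} := by
        refine Finset.card_le_card fun j hj => ?_
        simp only [Finset.mem_union, Finset.mem_filter, Finset.mem_univ, true_and] at hj ⊢
        rcases hj with hj | hj
        · exact Finset.inter_subset_left.trans hj
        · exact Finset.inter_subset_right.trans hj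
      have h4 : (({j | p ⊆ column F j} : Finset (Fin n)) ∩
          ({j | M ⊆ column F j} : Finset (Fin n))) =
          ({j | p ∪ M ⊆ column F j} : Finset (Fin n)) := by
        ext j
        simp [Finset.union_subset_iff]
      rw [h4] at h2
      simp only [Finset.sup_eq_union]
      omega
    · simpa using hML
    · intro hle
      have hM0 : M = ∅ := Finset.subset_empty.1 hle
      rw [mem_largeSets, hM0, Finset.card_empty, zero_add] at hML
      have := Finset.card_le_univ ({j | ∅ ⊆ column F j} : Finset (Fin n))
      rw [Fintype.card_fin] at this
      omega

end Columns

section DualCoeff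

variable {n : ℕ}

/-- The variant of `largeSets G` in which the columns `j` with `b j = true` no longer contain
themselves. -/
def largeSetsOf (G : Finset (Fin n × Fin n)) (b : Fin n → Bool) : Finset (Finset (Fin n)) :=
  {S | n < #S + #{j | S ⊆ column G j ∧ (b j = true → S ≠ column G j)}}

theorem mem_largeSetsOf {G : Finset (Fin n × Fin n)} {b : Fin n → Bool} {S : Finset (Fin n)} :
    S ∈ largeSetsOf G b ↔
      n < #S + #{j | S ⊆ column G j ∧ (b j = true → S ≠ column G j)} := by
  simp [largeSetsOf]

theorem nonempty_of_mem_largeSetsOf {G : Finset (Fin n × Fin n)} {b : Fin n → Bool}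
    {S : Finset (Fin n)} (hS : S ∈ largeSetsOf G b) : S.Nonempty := by
  rw [Finset.nonempty_iff_ne_empty]
  rintro rfl
  rw [mem_largeSetsOf, Finset.card_empty, zero_add] at hS
  exact absurd ((Finset.card_le_univ _).trans_eq (Fintype.card_fin n)) hS.not_ge

/-- The nonempty columns of a graph. -/
def columns (G : Finset (Fin n × Fin n)) : Finset (Finset (Fin n)) :=
  {S ∈ Finset.univ.image (column G) | S.Nonempty}

theorem mem_columns {G : Finset (Fin n × Fin n)} {S : Finset (Fin n)} :
    S ∈ columns G ↔ (∃ j, column G j = S) ∧ S.Nonempty := by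
  simp [columns]

theorem abs_chainSum_largeSetsOf_le (G : Finset (Fin n × Fin n)) (b : Fin n → Bool) :
    |chainSum (largeSetsOf G b) (columns G) ∅| ≤ 2 ^ n := by
  rcases (chainsAbove (largeSetsOf G b) (columns G) ∅).eq_empty_or_nonempty with he | ⟨C, hC⟩
  · simp [chainSum, he]
  obtain ⟨hCL, hC, -, hCA⟩ := mem_chainsAbove.1 hC
  have hAC : columns G ⊆ C := fun a ha =>
    hCA a ha (Finset.empty_ssubset.2 (mem_columns.1 ha).2)
  have hfill : FillsUpTo (largeSetsOf G b) (columns G) := by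
    intro s hs t hst ht
    by_cases htA : t ∈ columns G
    · exact hCL (hAC htA)
    have hne := nonempty_of_mem_largeSetsOf hs
    rw [mem_largeSetsOf] at hs ⊢
    refine hs.trans_le (add_le_add (Finset.card_le_card hst) (Finset.card_le_card ?_))
    intro j hj
    simp only [Finset.mem_filter, Finset.mem_univ, true_and] at hj ⊢
    have hj' : column G j ∈ columns G := mem_columns.2 ⟨⟨j, rfl⟩, hne.mono hj.1⟩
    exact ⟨ht _ hj' hj.1, fun _ h => htA (h ▸ hj')⟩
  have habove : ∀ s ∈ largeSetsOf G b, ∃ a ∈ columns G, s ⊆ a := by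
    intro s hs
    have hne := nonempty_of_mem_largeSetsOf hs
    rw [mem_largeSetsOf] at hs
    have hcard := (Finset.card_le_univ s).trans_eq (Fintype.card_fin n)
    obtain ⟨j, hj⟩ := Finset.card_pos.1 (show 0 < #{j | s ⊆ column G j ∧
      (b j = true → s ≠ column G j)} by omega)
    have hj := (Finset.mem_filter.1 hj).2.1
    exact ⟨column G j, mem_columns.2 ⟨⟨j, rfl⟩, hne.mono hj⟩, hj⟩
  simpa using abs_chainSum_le hfill (hC.mono (Finset.coe_subset.2 hAC)) habove ∅

open scoped Classical in
theorem chainSum_eq_sum_ite {α : Type*} [PartialOrder α] {L M A : Finset α} {s : α}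
    (hLM : L ⊆ M) :
    chainSum L A s = ∑ C ∈ chainsAbove M ∅ s,
      if (∀ a ∈ A, s < a → a ∈ C) ∧ C ⊆ L then (-1) ^ #C else 0 := by
  rw [← Finset.sum_filter, chainSum]
  refine Finset.sum_congr ?_ fun _ _ => rfl
  ext C
  simp only [mem_chainsAbove, Finset.mem_filter, Finset.notMem_empty, IsEmpty.forall_iff,
    implies_true, and_true]
  exact ⟨fun h => ⟨⟨h.1.trans hLM, h.2.1, h.2.2.1⟩, h.2.2.2, h.1⟩,
    fun h => ⟨h.2.2, h.1.2.1, h.1.2.2, h.2.1⟩⟩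

open scoped Classical in
/-- The coefficient at `G` of the indicator that all sets of the chain `C` are large. -/
theorem sum_powerset_subset_largeSets {C : Finset (Finset (Fin n))}
    (hC : IsChain (· ≤ ·) (C : Set (Finset (Fin n)))) (G : Finset (Fin n × Fin n)) :
    ∑ F ∈ G.powerset, (-1 : ℝ) ^ #(G \ F) * (if C ⊆ largeSets F then 1 else 0) =
      ∑ b : Fin n → Bool, (∏ j, columnSign (column G j) (b j)) *
        if columns G ⊆ C ∧ C ⊆ largeSetsOf G b then 1 else 0 := by
  set Φ : (Fin n → Finset (Finset (Fin n))) → ℝ :=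
    fun p => if ∀ S ∈ C, n < #S + #{j | S ∈ p j} then 1 else 0 with hΦ
  have h1 : ∀ F : Finset (Fin n × Fin n), (if C ⊆ largeSets F then (1 : ℝ) else 0) =
      Φ fun j => {S ∈ C | S ⊆ column F j} := by
    intro F
    simp only [hΦ]
    congr 1
    refine propext (forall₂_congr fun S hS => ?_)
    simp [mem_largeSets, hS]
  have h2 : ∀ b : Fin n → Bool, (if C ⊆ largeSetsOf G b then (1 : ℝ) else 0) =
      Φ fun j => {S ∈ C | S ⊆ column G j ∧ (b j = true → S ≠ column G j)} := by
    intro b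
    simp only [hΦ]
    congr 1
    refine propext (forall₂_congr fun S hS => ?_)
    simp [mem_largeSetsOf, hS]
  have h3 : ∀ b : Fin n → Bool,
      (∏ j, if (column G j).Nonempty → column G j ∈ C then columnSign (column G j) (b j) else 0) =
        (∏ j, columnSign (column G j) (b j)) * if columns G ⊆ C then 1 else 0 := by
    intro b
    by_cases h : columns G ⊆ C
    · rw [if_pos h, mul_one]
      exact Finset.prod_congr rfl fun j _ =>
        if_pos fun hj => h (mem_columns.2 ⟨⟨j, rfl⟩, hj⟩)
    · rw [if_neg h, mul_zero]
      obtain ⟨S, hS, hSC⟩ := Finset.not_subset.1 h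
      obtain ⟨⟨j, rfl⟩, hj⟩ := mem_columns.1 hS
      exact Finset.prod_eq_zero (Finset.mem_univ j) (if_neg fun h => hSC (h hj))
  simp_rw [h1]
  rw [sum_powerset_eq_sum_piFinset_column G fun H => Φ fun j => {S ∈ C | S ⊆ H j}]
  have key := sum_piFinset_prod_mul_eq (ι := Fin n) (t := fun j => (column G j).powerset)
    (w := fun j D => (-1) ^ #(column G j \ D)) (τ := fun _ D => ({S ∈ C | S ⊆ D} : Finset _))
    (u := fun _ => (Finset.univ : Finset Bool))
    (v := fun j b =>
      if (column G j).Nonempty → column G j ∈ C then columnSign (column G j) b else 0)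
    (ρ := fun j b => ({S ∈ C | S ⊆ column G j ∧ (b = true → S ≠ column G j)} : Finset _))
    (fun j φ => by convert sum_powerset_eq_sum_bool hC (column G j) φ) Φ
  rw [Fintype.piFinset_univ] at key
  convert key using 1
  refine Finset.sum_congr rfl fun b _ => ?_
  rw [h3, ← h2, mul_assoc]
  congr 1
  split_ifs <;> simp_all

theorem dualCoeff_eq_neg_sum {G : Finset (Fin n × Fin n)} (hG : G.Nonempty) :
    dualCoeff n G = -∑ b : Fin n → Bool, (∏ j, columnSign (column G j) (b j)) *
      chainSum (largeSetsOf G b) (columns G) ∅ := by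
  classical
  obtain ⟨x, hx⟩ := hG
  have hzero := sum_powerset_neg_one_pow_mul_eq_zero hx (f := fun _ => 1) fun _ _ => rfl
  have h1 : dualCoeff n G =
      -∑ F ∈ G.powerset, (-1) ^ #(G \ F) * chainSum (largeSets F) ∅ ∅ := by
    unfold dualCoeff
    simp_rw [bpmStar_eq_one_sub_chainSum, mul_sub]
    rw [Finset.sum_sub_distrib, hzero, zero_sub]
  rw [h1, neg_inj]
  simp_rw [chainSum_eq_sum_ite (Finset.subset_univ _), Finset.mul_sum]
  rw [Finset.sum_comm, Finset.sum_comm (s := Finset.univ)]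
  refine Finset.sum_congr rfl fun C hC => ?_
  obtain ⟨-, hC, -⟩ := mem_chainsAbove.1 hC
  have h := congrArg (fun r => r * (-1 : ℝ) ^ #C)
    (sum_powerset_subset_largeSets hC G)
  simp only [Finset.sum_mul] at h
  convert h using 2 with F _ b _
  · rw [mul_assoc]
    simp
  · have : (∀ a ∈ columns G, ∅ < a → a ∈ C) ↔ columns G ⊆ C :=
      ⟨fun h a ha => h a ha (Finset.empty_ssubset.2 (mem_columns.1 ha).2), fun h a ha _ => h ha⟩
    rw [mul_assoc]
    simp only [this]
    simp

end DualCoeff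

/-- For every graph `G ⊆ K_{n,n}`, the dual coefficient satisfies `|a*_G| ≤ 2^{2n}`. -/
theorem abs_dual_coeff_le (n : ℕ) (G : Finset (Fin n × Fin n)) :
    |dualCoeff n G| ≤ 2 ^ (2 * n) := by
  rcases G.eq_empty_or_nonempty with rfl | hG
  · have h1 : (1 : ℝ) ≤ 2 ^ (2 * n) := one_le_pow₀ one_le_two
    have h2 : |bpmStar n ∅| ≤ 1 := by
      unfold bpmStar
      split_ifs <;> simp
    simpa [dualCoeff] using h2.trans h1
  rw [dualCoeff_eq_neg_sum hG, abs_neg]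
  calc _ ≤ ∑ b : Fin n → Bool, |(∏ j, columnSign (column G j) (b j)) *
        chainSum (largeSetsOf G b) (columns G) ∅| := Finset.abs_sum_le_sum_abs _ _
    _ ≤ ∑ _b : Fin n → Bool, 2 ^ n := by
        refine Finset.sum_le_sum fun b _ => ?_
        rw [abs_mul, Finset.abs_prod]
        refine (mul_le_of_le_one_left (abs_nonneg _) ?_).trans (abs_chainSum_largeSetsOf_le G b)
        exact Finset.prod_le_one (fun _ _ => abs_nonneg _) fun _ _ => abs_columnSign_le _ _
    _ = 2 ^ (2 * n) := by
        simp [two_mul, pow_add]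
end
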